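/- arXiv:1206.4279 — 8 statements merged into one kernel-verified Lean document; each statement's English description precedes it below -/
import Mathlib

section
/- Let n > 2 be an integer with at least two distinct prime divisors, and let p₁ < p₂ be the two smallest prime divisors of n. Let q be a prime power and let G be a group with SL_n(q) ≤ G ≤ GL_n(q). Then γ(G) ≤ (1 − 1/p₁)(1 − 1/p₂)·n/2 + 2. -/
/-- `k` classes of proper subgroups whose conjugates cover `G`. -/
def IsNormalCover (G : Type*) [Group G] (k : ℕ) : Prop :=
  ∃ H : Fin k → Subgroup G, (∀ i, H i ≠ ⊤) ∧
    ∀ g : G, ∃ i : Fin k, ∃ x : G, x * g * x⁻¹ ∈ H i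

/-- `γ(G)`: the least number of conjugacy classes of proper subgroups needed to cover `G`. -/
noncomputable def gammaCover (G : Type*) [Group G] : ℕ := sInf {k | IsNormalCover G k}

/-- A set of conjugacy classes is independent if any pair of elements from two distinct
classes of the set generates `G`. -/
def IsIndependentClasses (G : Type*) [Group G] (S : Finset (ConjClasses G)) : Prop :=
  ∀ c ∈ S, ∀ d ∈ S, c ≠ d → ∀ x ∈ c.carrier, ∀ y ∈ d.carrier,
    Subgroup.closure {x, y} = ⊤

/-- `κ(G)`: the size of the largest independent set of conjugacy classes of `G`. -/
noncomputable def kappaIndep (G : Type*) [Group G] : ℕ :=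
  sSup {k | ∃ S : Finset (ConjClasses G), S.card = k ∧ IsIndependentClasses G S}

/-- `ν(n)`: the number of distinct prime divisors of `n`. -/
def nuPrimes (n : ℕ) : ℕ := n.primeFactors.card

/-- Lehmer's partial totient `φ(k, t, n)`: the number of integers `x` coprime to `n`
with `n t / k < x < n (t+1) / k`. -/
def partialTotient (k t n : ℕ) : ℕ :=
  ((Finset.range (n * (t + 1) + 1)).filter
    (fun x => Nat.Coprime x n ∧ (n * t : ℚ) / k < (x : ℚ) ∧ (x : ℚ) < (n * (t + 1) : ℚ) / k)).card

/-- The copy of `SL_n(F)` inside `GL_n(F)`. -/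
def SLinGL (n : ℕ) (F : Type*) [Field F] : Subgroup (GL (Fin n) F) :=
  (Matrix.SpecialLinearGroup.toGL (n := Fin n) (R := F)).range

section Polynomials

open Polynomial

variable {F : Type*} [Field F]

/-- If `f` has a root in `F[X]/(π)` for every irreducible factor `π` of `m`, then `f` has a root
modulo `m` up to nilpotents. -/
theorem exists_dvd_comp_pow (f m : F[X])
    (h : ∀ π : F[X], Irreducible π → π ∣ m → ∃ r : F[X], π ∣ f.comp r) (hm : m ≠ 0) :
    ∃ (r : F[X]) (k : ℕ), m ∣ f.comp r ^ k := by
  induction m using UniqueFactorizationMonoid.induction_on_coprime with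
  | h0 => exact absurd rfl hm
  | h1 hx => exact ⟨0, 0, hx.dvd⟩
  | hpr i hp =>
    rename_i π
    rcases Nat.eq_zero_or_pos i with rfl | hi
    · exact ⟨0, 0, by simp⟩
    · obtain ⟨r, hr⟩ := h π hp.irreducible (dvd_pow_self π hi.ne')
      exact ⟨r, i, pow_dvd_pow_of_dvd hr i⟩
  | hcp hrel hx hy =>
    rename_i x y
    obtain ⟨r, k, hr⟩ := hx (fun π hπ hd => h π hπ (hd.mul_right y)) (left_ne_zero_of_mul hm)
    obtain ⟨s, l, hs⟩ := hy (fun π hπ hd => h π hπ (hd.mul_left x)) (right_ne_zero_of_mul hm)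
    obtain ⟨a, b, hab⟩ := hrel.isCoprime
    have key : ∀ (z t u : F[X]) (j : ℕ), z ∣ u - t → z ∣ f.comp t ^ j →
        ∀ j', j ≤ j' → z ∣ f.comp u ^ j' := by
      intro z t u j hz hd j' hj
      refine dvd_trans ?_ (pow_dvd_pow _ hj)
      have h1 : z ∣ f.comp u - f.comp t := hz.trans (by
        simpa [comp, eval₂_eq_eval_map] using sub_dvd_eval_sub u t (f.map C))
      have h2 : z ∣ f.comp u ^ j - f.comp t ^ j := h1.trans (sub_dvd_pow_sub_pow _ _ j)
      simpa using dvd_add h2 hd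
    refine ⟨b * y * r + a * x * s, k + l, hrel.isCoprime.mul_dvd
      (key x r _ k ⟨a * (s - r), ?_⟩ hr _ (by omega))
      (key y s _ l ⟨b * (r - s), ?_⟩ hs _ (by omega))⟩
    · linear_combination r * hab
    · linear_combination s * hab

theorem aeval_pow_card_pow {A : Type*} [Ring A] [Algebra F A] [Fintype F] (f : F[X]) (y : A)
    (k : ℕ) : aeval (y ^ Fintype.card F ^ k) f = aeval y f ^ Fintype.card F ^ k := by
  induction k with
  | zero => simp
  | succ k ih =>
    rw [pow_succ, pow_mul, pow_mul, ← ih, ← map_pow, ← FiniteField.expand_card, expand_aeval]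

theorem exists_algHom_commute {L V : Type*} [Field L] [Algebra F L] [Finite F]
    [FiniteDimensional F L] [AddCommGroup V] [Module F V] [FiniteDimensional F V]
    (T : Module.End F V)
    (h : ∀ π : F[X], Irreducible π → π ∣ minpoly F T → Module.finrank F L ∣ π.natDegree) :
    ∃ ρ : L →ₐ[F] Module.End F V, ∀ a, Commute T (ρ a) := by
  have := Fintype.ofFinite F
  let pb := Field.powerBasisOfFiniteOfSeparable F L
  set f := minpoly F pb.gen
  obtain ⟨r, k, hr⟩ := exists_dvd_comp_pow f (minpoly F T) (fun π hπ hd => by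
    have : Fact (Irreducible π) := ⟨hπ⟩
    have : Module.Finite F (AdjoinRoot π) := (AdjoinRoot.powerBasis hπ.ne_zero).finite
    have : Finite (AdjoinRoot π) := Module.finite_of_finite F
    obtain ⟨φ⟩ := FiniteField.nonempty_algHom_of_finrank_dvd (F := F) (K := L)
      (L := AdjoinRoot π) (by
        rw [(AdjoinRoot.powerBasis hπ.ne_zero).finrank, AdjoinRoot.powerBasis_dim]
        exact h π hπ hd)
    obtain ⟨r, hr⟩ := AdjoinRoot.mk_surjective (φ pb.gen)
    refine ⟨r, AdjoinRoot.mk_eq_zero.1 ?_⟩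
    rw [← AdjoinRoot.aeval_eq, aeval_comp, AdjoinRoot.aeval_eq, hr, aeval_algHom_apply,
      minpoly.aeval, map_zero])
    (minpoly.ne_zero (Algebra.IsIntegral.isIntegral T))
  set N := Fintype.card F ^ k
  have hN : k ≤ N := (Nat.lt_pow_self Fintype.one_lt_card).le
  have h0 : aeval (aeval T (r ^ N)) f = 0 := by
    rw [map_pow, aeval_pow_card_pow, ← aeval_comp, ← map_pow]
    exact (minpoly.dvd_iff).1 (hr.trans (pow_dvd_pow _ hN))
  refine ⟨pb.lift _ h0, fun a => ?_⟩
  obtain ⟨g, rfl⟩ := pb.exists_eq_aeval' a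
  rw [PowerBasis.lift_aeval, ← aeval_comp]
  conv => arg 1; rw [← aeval_X (R := F) T]
  exact (Commute.all _ _).map (aeval T)

/-- An irreducible factor of the minimal polynomial gives an invariant subspace. -/
theorem exists_invariant_le_ker {V : Type*} [AddCommGroup V] [Module F V] [FiniteDimensional F V]
    (T : Module.End F V) {π : F[X]} (hπ : Irreducible π) (hd : π ∣ minpoly F T) :
    ∃ W : Submodule F V, W ≤ W.comap T ∧ W ≤ LinearMap.ker (aeval T π) ∧
      Module.finrank F W = π.natDegree := by
  obtain ⟨v, hv, hv0⟩ : ∃ v, aeval T π v = 0 ∧ v ≠ 0 := by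
    by_contra! hcon
    have hinj : Function.Injective (aeval T π) :=
      (injective_iff_map_eq_zero _).2 hcon
    obtain ⟨c, hc⟩ := hd
    have hm := minpoly.ne_zero (Algebra.IsIntegral.isIntegral (R := F) T)
    have hc0 : c ≠ 0 := by rintro rfl; simp [hc] at hm
    have : aeval T c = 0 := by
      ext x
      apply hinj
      have := minpoly.aeval F T
      rw [hc, map_mul] at this
      simpa using LinearMap.congr_fun this x
    obtain ⟨d, hd⟩ := hc ▸ minpoly.dvd F T this
    refine hπ.not_isUnit (.of_mul_eq_one d (mul_left_cancel₀ hc0 ?_))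
    linear_combination -hd
  let φ : F[X] →ₗ[F] V := (LinearMap.applyₗ v).comp (aeval T).toLinearMap
  have hφ : ∀ g, φ g = aeval T g v := fun g => rfl
  have hker : LinearMap.ker φ = (Ideal.span {π}).restrictScalars F := by
    ext g
    simp only [LinearMap.mem_ker, Submodule.restrictScalars_mem, Ideal.mem_span_singleton, hφ]
    constructor
    · intro hg
      by_contra hnd
      obtain ⟨a, b, hab⟩ := (hπ.coprime_iff_not_dvd.2 hnd)
      apply hv0
      have := congrArg (fun t => aeval T t v) hab
      simpa [hv, hg] using this.symm
    · rintro ⟨c, rfl⟩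
      rw [mul_comm]
      simp [hv]
  refine ⟨LinearMap.range φ, ?_, ?_, ?_⟩
  · rintro _ ⟨g, rfl⟩
    exact ⟨X * g, by simp [hφ]⟩
  · rintro _ ⟨g, rfl⟩
    rw [LinearMap.mem_ker, hφ, ← Module.End.mul_apply, ← map_mul, mul_comm, map_mul]
    simp [hv]
  · rw [← φ.quotKerEquivRange.finrank_eq, hker]
    exact finrank_quotient_span_eq_natDegree (f := π)

theorem aeval_dualMap {V : Type*} [AddCommGroup V] [Module F V] (T : Module.End F V) (f : F[X]) :
    aeval (R := F) (A := Module.End F (Module.Dual F V)) T.dualMap f = (aeval T f).dualMap := by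
  ext φ v
  induction f using Polynomial.induction_on' generalizing φ v with
  | add p q hp hq => simp [hp, hq]
  | monomial n a =>
    have : ∀ φ : Module.Dual F V, (T.dualMap ^ n : Module.End F (Module.Dual F V)) φ v =
        φ ((T ^ n) v) := by
      induction n with
      | zero => simp
      | succ n ih => intro φ; rw [pow_succ, pow_succ']; simp [ih]
    simp [aeval_monomial, this]

theorem minpoly_dvd_minpoly_dualMap {V : Type*} [AddCommGroup V] [Module F V]
    (T : Module.End F V) :
    minpoly F T ∣ minpoly F (T.dualMap : Module.End F (Module.Dual F V)) := by
  refine minpoly.dvd F T (LinearMap.ext fun v => ?_)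
  have h := minpoly.aeval F (T.dualMap : Module.End F (Module.Dual F V))
  rw [aeval_dualMap] at h
  exact (Module.forall_dual_apply_eq_zero_iff F _).1 fun φ =>
    LinearMap.congr_fun (LinearMap.congr_fun h φ) v

/-- A squarefree divisor of the minimal polynomial gives an invariant subspace whose dimension is
the degree of the divisor. -/
theorem exists_invariant_of_squarefree {V : Type*} [AddCommGroup V] [Module F V]
    [FiniteDimensional F V] (T : Module.End F V) {g : F[X]} (hg : Squarefree g)
    (hd : g ∣ minpoly F T) :
    ∃ W : Submodule F V, W ≤ W.comap T ∧ W ≤ LinearMap.ker (aeval T g) ∧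
      Module.finrank F W = g.natDegree := by
  induction g using UniqueFactorizationMonoid.induction_on_coprime with
  | h0 => exact absurd hg not_squarefree_zero
  | h1 hx => exact ⟨⊥, by simp, by simp, by simp [natDegree_eq_zero_of_isUnit hx]⟩
  | hpr i hp =>
    rcases Nat.lt_or_ge i 2 with hi | hi
    · interval_cases i
      · exact ⟨⊥, by simp, by simp, by simp⟩
      · rw [pow_one] at hd ⊢
        exact exists_invariant_le_ker T hp.irreducible hd
    · refine absurd (hg _ ?_) hp.not_isUnit
      rw [← pow_two]
      exact pow_dvd_pow _ hi
  | hcp hrel hx hy =>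
    rename_i x y
    obtain ⟨W, hW, hWk, hWd⟩ := hx hg.of_mul_left (dvd_of_mul_right_dvd hd)
    obtain ⟨U, hU, hUk, hUd⟩ := hy hg.of_mul_right (dvd_of_mul_left_dvd hd)
    refine ⟨W ⊔ U, sup_le (hW.trans (Submodule.comap_mono le_sup_left))
      (hU.trans (Submodule.comap_mono le_sup_right)), sup_le (fun v hv => ?_) (fun v hv => ?_), ?_⟩
    · have : aeval T x v = 0 := hWk hv
      rw [LinearMap.mem_ker, mul_comm, map_mul, Module.End.mul_apply, this, map_zero]
    · have : aeval T y v = 0 := hUk hv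
      rw [LinearMap.mem_ker, map_mul, Module.End.mul_apply, this, map_zero]
    · have hdis : W ⊓ U = ⊥ :=
        ((disjoint_ker_aeval_of_isCoprime T hrel.isCoprime).mono hWk hUk).eq_bot
      have := Submodule.finrank_sup_add_finrank_inf_eq W U
      rw [hdis, finrank_bot, hWd, hUd] at this
      rw [natDegree_mul (left_ne_zero_of_mul hg.ne_zero) (right_ne_zero_of_mul hg.ne_zero)]
      simpa using this

theorem exists_invariant_of_squarefree_codim {V : Type*} [AddCommGroup V] [Module F V]
    [FiniteDimensional F V] (T : Module.End F V) {g : F[X]} (hg : Squarefree g)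
    (hd : g ∣ minpoly F T) :
    ∃ W : Submodule F V, W ≤ W.comap T ∧ g.natDegree + Module.finrank F W = Module.finrank F V := by
  obtain ⟨W, hW, -, hWd⟩ := exists_invariant_of_squarefree
    (T.dualMap : Module.End F (Module.Dual F V)) hg (hd.trans (minpoly_dvd_minpoly_dualMap T))
  refine ⟨W.dualCoannihilator, fun v hv => ?_, ?_⟩
  · rw [Submodule.mem_comap, Submodule.mem_dualCoannihilator]
    rw [Submodule.mem_dualCoannihilator] at hv
    exact fun φ hφ => hv _ (hW hφ)
  · rw [← hWd]
    exact Subspace.finrank_add_finrank_dualCoannihilator_eq W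

/-- If the degrees of the irreducible factors of the minimal polynomial of `T` are neither all
divisible by `p` nor all divisible by `r`, then `T` has an invariant subspace of small dimension
coprime to `p * r`. -/
theorem exists_invariant_coprime {V : Type*} [AddCommGroup V] [Module F V]
    [FiniteDimensional F V] (T : Module.End F V) {p r : ℕ} (hp : p.Prime) (hr : r.Prime)
    (hpr : p ≠ r) (hpn : p ∣ Module.finrank F V) (hrn : r ∣ Module.finrank F V)
    (h₁ : ∃ π : F[X], Irreducible π ∧ π ∣ minpoly F T ∧ ¬ p ∣ π.natDegree)
    (h₂ : ∃ π : F[X], Irreducible π ∧ π ∣ minpoly F T ∧ ¬ r ∣ π.natDegree) :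
    ∃ W : Submodule F V, W ≤ W.comap T ∧ (Module.finrank F W).Coprime (p * r) ∧
      2 * Module.finrank F W < Module.finrank F V := by
  have cop : ∀ k : ℕ, k.Coprime (p * r) ↔ ¬ p ∣ k ∧ ¬ r ∣ k := fun k => by
    rw [Nat.coprime_mul_iff_right, Nat.coprime_comm, hp.coprime_iff_not_dvd, Nat.coprime_comm,
      hr.coprime_iff_not_dvd]
  obtain ⟨g, hg, hgd, hgc⟩ : ∃ g : F[X], Squarefree g ∧ g ∣ minpoly F T ∧
      g.natDegree.Coprime (p * r) := by
    obtain ⟨π, hπ, hπd, hπp⟩ := h₁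
    obtain ⟨σ, hσ, hσd, hσr⟩ := h₂
    by_cases hπr : r ∣ π.natDegree
    · by_cases hσp : p ∣ σ.natDegree
      · have hc : IsCoprime π σ := by
          rw [hπ.coprime_iff_not_dvd]
          intro hdvd
          have := natDegree_eq_of_degree_eq (degree_eq_degree_of_associated
            (hπ.associated_of_dvd hσ hdvd))
          exact hπp (this ▸ hσp)
        refine ⟨π * σ, (squarefree_mul_iff).2 ⟨hc.isRelPrime, hπ.squarefree, hσ.squarefree⟩,
          hc.mul_dvd hπd hσd, ?_⟩
        rw [natDegree_mul hπ.ne_zero hσ.ne_zero, cop]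
        exact ⟨fun h => hπp ((Nat.dvd_add_left hσp).1 h), fun h => hσr ((Nat.dvd_add_right hπr).1 h)⟩
      · exact ⟨σ, hσ.squarefree, hσd, (cop _).2 ⟨hσp, hσr⟩⟩
    · exact ⟨π, hπ.squarefree, hπd, (cop _).2 ⟨hπp, hπr⟩⟩
  rcases lt_trichotomy (2 * g.natDegree) (Module.finrank F V) with hlt | heq | hgt
  · obtain ⟨W, hW, -, hWd⟩ := exists_invariant_of_squarefree T hg hgd
    exact ⟨W, hW, hWd ▸ hgc, hWd ▸ hlt⟩
  · exfalso
    rw [cop] at hgc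
    rw [← heq] at hpn hrn
    have h1 := (Nat.prime_dvd_prime_iff_eq hp Nat.prime_two).1
      ((hp.dvd_mul.1 hpn).resolve_right hgc.1)
    have h2 := (Nat.prime_dvd_prime_iff_eq hr Nat.prime_two).1
      ((hr.dvd_mul.1 hrn).resolve_right hgc.2)
    omega
  · obtain ⟨W, hW, hWd⟩ := exists_invariant_of_squarefree_codim T hg hgd
    refine ⟨W, hW, ?_, by omega⟩
    rw [cop] at hgc ⊢
    rw [← hWd] at hpn hrn
    exact ⟨fun h => hgc.1 ((Nat.dvd_add_left h).1 hpn), fun h => hgc.2 ((Nat.dvd_add_left h).1 hrn)⟩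

end Polynomials

section Subgroups

open scoped Pointwise

variable {F V : Type*} [Field F] [AddCommGroup V] [Module F V]

theorem LinearEquiv.smul_submodule_eq_of_le_comap [FiniteDimensional F V] (g : V ≃ₗ[F] V)
    {W : Submodule F V} (h : W ≤ W.comap (g : V →ₗ[F] V)) : g • W = W :=
  Submodule.eq_of_le_of_finrank_eq (Submodule.map_le_iff_le_comap.2 h) (g.finrank_map_eq W)

theorem exists_det_eq_mem_stabilizer [FiniteDimensional F V] {W : Submodule F V} (hW : W ≠ ⊤)
    (d : Fˣ) : ∃ h ∈ MulAction.stabilizer (V ≃ₗ[F] V) W, LinearEquiv.det h = d := by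
  obtain ⟨u, -, hu⟩ := SetLike.exists_of_lt hW.lt_top
  obtain ⟨φ, hφu, hφW⟩ := Submodule.exists_le_ker_of_notMem hu
  have hd : 1 + φ (((d : F) - 1) • (φ u)⁻¹ • u) = d := by simp [hφu]
  refine ⟨LinearEquiv.dilatransvection (f := φ) (v := ((d : F) - 1) • (φ u)⁻¹ • u)
    (by rw [hd]; exact d.isUnit), ?_, ?_⟩
  · refine LinearEquiv.smul_submodule_eq_of_le_comap _ fun w hw => ?_
    have : φ w = 0 := hφW hw
    simpa [LinearMap.transvection.apply, this] using hw
  · ext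
    rw [LinearEquiv.coe_det, LinearEquiv.dilatransvection.coe_toLinearMap,
      LinearMap.transvection.det, hd]

theorem exists_det_eq_one_notMem_stabilizer {W : Submodule F V}
    (hb : W ≠ ⊥) (ht : W ≠ ⊤) :
    ∃ h : V ≃ₗ[F] V, LinearEquiv.det h = 1 ∧ h ∉ MulAction.stabilizer (V ≃ₗ[F] V) W := by
  obtain ⟨u, -, hu⟩ := SetLike.exists_of_lt ht.lt_top
  obtain ⟨w, hw, hw0⟩ := W.exists_mem_ne_zero_of_ne_bot hb
  have hwu : w ∉ F ∙ u := by
    rw [Submodule.mem_span_singleton]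
    rintro ⟨c, rfl⟩
    have hc : c ≠ 0 := by rintro rfl; simp at hw0
    exact hu ((W.smul_mem_iff hc).1 hw)
  obtain ⟨φ, hφw, hφu⟩ := Submodule.exists_le_ker_of_notMem hwu
  have hφu : φ u = 0 := hφu (Submodule.mem_span_singleton_self u)
  refine ⟨LinearEquiv.transvection hφu, LinearEquiv.transvection.det_eq_one hφu, fun h => ?_⟩
  have h1 : LinearEquiv.transvection hφu • w ∈ LinearEquiv.transvection hφu • W :=
    Submodule.smul_mem_pointwise_smul _ _ _ hw
  rw [MulAction.mem_stabilizer_iff.1 h, LinearEquiv.smul_def, LinearEquiv.transvection.apply,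
    W.add_mem_iff_right hw, W.smul_mem_iff hφw] at h1
  exact hu h1

theorem exists_smul_submodule_eq [FiniteDimensional F V] {W U : Submodule F V}
    (h : Module.finrank F W = Module.finrank F U) : ∃ e : V ≃ₗ[F] V, e • W = U := by
  obtain ⟨W', hW'⟩ := W.exists_isCompl
  obtain ⟨U', hU'⟩ := U.exists_isCompl
  have h' : Module.finrank F W' = Module.finrank F U' := by
    have h1 := Submodule.finrank_add_eq_of_isCompl hW'
    have h2 := Submodule.finrank_add_eq_of_isCompl hU'
    omega
  let a := LinearEquiv.ofFinrankEq W U h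
  let e : V ≃ₗ[F] V := (W.prodEquivOfIsCompl W' hW').symm ≪≫ₗ
    (a.prodCongr (LinearEquiv.ofFinrankEq W' U' h')) ≪≫ₗ U.prodEquivOfIsCompl U' hU'
  refine ⟨e, Submodule.eq_of_le_of_finrank_eq ?_ ((e.finrank_map_eq W).trans h)⟩
  refine Submodule.map_le_iff_le_comap.2 fun w hw => ?_
  have : e w = a ⟨w, hw⟩ := by
    have h1 : (W.prodEquivOfIsCompl W' hW').symm w = (⟨w, hw⟩, 0) :=
      Submodule.prodEquivOfIsCompl_symm_apply_left W W' hW' ⟨w, hw⟩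
    simp [e, h1]
  change e w ∈ U
  rw [this]
  exact (a ⟨w, hw⟩).2

variable {L : Type*} [Field L] [Algebra F L]

/-- The linear automorphisms of `V` which are `L`-linear for the action of `L` given by `ρ`. -/
def linearCommutant (ρ : L →ₐ[F] Module.End F V) : Subgroup (V ≃ₗ[F] V) where
  carrier := {g | ∀ a v, g (ρ a v) = ρ a (g v)}
  one_mem' _ _ := rfl
  mul_mem' {g h} hg hh a v := by simp [LinearEquiv.mul_apply, hg a, hh a]
  inv_mem' {g} hg a v := by
    apply g.injective
    rw [hg a]
    simp [LinearEquiv.coe_inv]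

theorem exists_conj_algHom {V' : Type*} [AddCommGroup V'] [Module F V'] [FiniteDimensional F V]
    [FiniteDimensional F V'] [FiniteDimensional F L] (ρ : L →ₐ[F] Module.End F V)
    (ρ' : L →ₐ[F] Module.End F V') (h : Module.finrank F V = Module.finrank F V') :
    ∃ e : V ≃ₗ[F] V', ∀ a v, e (ρ a v) = ρ' a (e v) := by
  let _ : Module L V := Module.compHom V ρ.toRingHom
  let _ : Module L V' := Module.compHom V' ρ'.toRingHom
  have hρ : ∀ (a : L) (v : V), a • v = ρ a v := fun _ _ => rfl
  have hρ' : ∀ (a : L) (v : V'), a • v = ρ' a v := fun _ _ => rfl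
  have : IsScalarTower F L V := ⟨fun c a v => by simp [hρ]⟩
  have : IsScalarTower F L V' := ⟨fun c a v => by simp [hρ']⟩
  have : FiniteDimensional L V := .right F L V
  have : FiniteDimensional L V' := .right F L V'
  have hL : Module.finrank L V = Module.finrank L V' := by
    rw [← Module.finrank_mul_finrank F L V, ← Module.finrank_mul_finrank F L V'] at h
    exact Nat.eq_of_mul_eq_mul_left Module.finrank_pos h
  let e := LinearEquiv.ofFinrankEq V V' hL
  exact ⟨e.restrictScalars F, fun a v => e.map_smul a v⟩

theorem exists_det_eq_mem_linearCommutant [FiniteDimensional F V] [Nontrivial V] [Finite L]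
    (ρ : L →ₐ[F] Module.End F V) (d : Fˣ) : ∃ h ∈ linearCommutant ρ, LinearEquiv.det h = d := by
  let _ : Module L V := Module.compHom V ρ.toRingHom
  have hρ : ∀ (a : L) (v : V), a • v = ρ a v := fun _ _ => rfl
  have : IsScalarTower F L V := ⟨fun c a v => by simp [hρ]⟩
  have : FiniteDimensional L V := .right F L V
  obtain ⟨c, hc⟩ := FiniteField.unitsMap_norm_surjective F L d
  obtain ⟨h, -, hh⟩ := exists_det_eq_mem_stabilizer (F := L) (V := V) (W := ⊥) bot_ne_top c
  refine ⟨LinearEquiv.restrictScalars F h, fun a v => map_smul h a v, ?_⟩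
  rw [← hc, ← hh]
  ext
  rw [LinearEquiv.coe_det, Units.coe_map, LinearEquiv.coe_det]
  exact LinearMap.det_restrictScalars (R := F) (S := L) (A := V) (f := (h : V →ₗ[L] V))

theorem exists_det_eq_one_notMem_linearCommutant [FiniteDimensional F V] [Nontrivial V]
    (ρ : L →ₐ[F] Module.End F V) (hL : 1 < Module.finrank F L) :
    ∃ h : V ≃ₗ[F] V, LinearEquiv.det h = 1 ∧ h ∉ linearCommutant ρ := by
  obtain ⟨a, ha⟩ : ∃ a : L, a ∉ (⊥ : Subalgebra F L) := by
    by_contra! hcon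
    have : (⊥ : Subalgebra F L) = ⊤ := eq_top_iff.2 fun x _ => hcon x
    rw [Subalgebra.bot_eq_top_iff_finrank_eq_one] at this
    omega
  have hρ : Function.Injective ρ := ρ.toRingHom.injective
  obtain ⟨v, hv⟩ : ∃ v, LinearIndependent F ![v, ρ a v] := by
    by_contra! hcon
    obtain ⟨c, hc⟩ := LinearMap.exists_eq_smul_id_of_forall_notLinearIndependent hcon
    refine ha ⟨c, hρ ?_⟩
    rw [hc]
    exact (ρ.commutes c).trans (Algebra.algebraMap_eq_smul_one c)
  have hva : v ∉ F ∙ (ρ a v) := by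
    rw [LinearIndependent.pair_iff] at hv
    rw [Submodule.mem_span_singleton]
    rintro ⟨c, hc⟩
    simpa using (hv 1 (-c) (by simp [hc])).1
  obtain ⟨φ, hφv, hφ⟩ := Submodule.exists_le_ker_of_notMem hva
  have hφ : φ (ρ a v) = 0 := hφ (Submodule.mem_span_singleton_self _)
  refine ⟨LinearEquiv.transvection hφ, LinearEquiv.transvection.det_eq_one hφ, fun h => ?_⟩
  have h1 := h a v
  rw [LinearEquiv.transvection.apply, LinearEquiv.transvection.apply, hφ] at h1
  have ha0 : a ≠ 0 := by rintro rfl; exact ha (zero_mem _)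
  have h2 : ρ (a⁻¹ * a⁻¹) (ρ (a * a) v) = 0 := by
    have : ρ a (ρ a v) = 0 := by simpa [hφv] using h1
    rw [map_mul ρ a a, Module.End.mul_apply, this, map_zero]
  rw [← Module.End.mul_apply, ← map_mul] at h2
  have h3 : a⁻¹ * a⁻¹ * (a * a) = 1 := by field_simp
  rw [h3, map_one] at h2
  exact hφv (by rw [show v = 0 from h2, map_zero])

theorem exists_algHom_end [FiniteDimensional F V] [FiniteDimensional F L]
    (h : Module.finrank F L ∣ Module.finrank F V) : Nonempty (L →ₐ[F] Module.End F V) := by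
  obtain ⟨m, hm⟩ := h
  let e : (Fin m → L) ≃ₗ[F] V := LinearEquiv.ofFinrankEq _ _ (by
    rw [hm, Module.finrank_pi_fintype]; simp [mul_comm])
  exact ⟨(LinearEquiv.conjAlgEquiv F e).toAlgHom.comp (Algebra.lsmul F F (Fin m → L))⟩

end Subgroups

section Counting

theorem card_range_mul_filter_coprime (a m : ℕ) :
    ((Finset.range (a * m)).filter (fun k => k.Coprime a)).card = m * a.totient := by
  induction m with
  | zero => simp
  | succ m ih =>
    have hsplit : Finset.range (a * (m + 1)) =
        Finset.range (a * m) ∪ Finset.Ico (a * m) (a * m + a) := by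
      ext k
      simp only [Finset.mem_range, Finset.mem_union, Finset.mem_Ico]
      rw [mul_add, mul_one]
      omega
    have hdisj : Disjoint (Finset.range (a * m)) (Finset.Ico (a * m) (a * m + a)) := by
      rw [Finset.disjoint_left]
      intro k h1 h2
      simp only [Finset.mem_range, Finset.mem_Ico] at h1 h2
      omega
    rw [hsplit, Finset.filter_union, Finset.card_union_of_disjoint
      (Finset.disjoint_filter_filter hdisj), ih, add_mul, one_mul]
    congr 1
    simpa only [Nat.coprime_comm] using Nat.filter_coprime_Ico_eq_totient a (a * m)

theorem two_mul_card_filter_coprime_le {a n : ℕ} (ha : a ≠ 1) (han : a ∣ n) :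
    2 * ((Finset.range n).filter (fun k => k.Coprime a ∧ 2 * k < n)).card ≤
      ((Finset.range n).filter (fun k => k.Coprime a)).card := by
  set K := (Finset.range n).filter (fun k => k.Coprime a ∧ 2 * k < n)
  have hK : ∀ k ∈ K, 0 < k ∧ k.Coprime a ∧ 2 * k < n := by
    intro k hk
    obtain ⟨-, h1, h2⟩ := Finset.mem_filter.1 hk
    refine ⟨Nat.pos_of_ne_zero ?_, h1, h2⟩
    rintro rfl
    exact ha (Nat.coprime_zero_left a |>.1 h1)
  have himg : (K.image (n - ·)).card = K.card := by
    refine Finset.card_image_of_injOn fun x hx y hy hxy => ?_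
    have h1 := hK x hx
    have h2 := hK y hy
    have h3 : n - x = n - y := hxy
    omega
  have hdisj : Disjoint K (K.image (n - ·)) := by
    rw [Finset.disjoint_left]
    intro x hx hx'
    obtain ⟨y, hy, rfl⟩ := Finset.mem_image.1 hx'
    have h1 := hK _ hx
    have h2 := hK y hy
    omega
  rw [two_mul]
  nth_rewrite 2 [← himg]
  rw [← Finset.card_union_of_disjoint hdisj]
  refine Finset.card_le_card (Finset.union_subset (fun k hk => ?_) (fun k hk => ?_))
  · have := hK k hk
    exact Finset.mem_filter.2 ⟨Finset.mem_range.2 (by omega), this.2.1⟩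
  · obtain ⟨y, hy, rfl⟩ := Finset.mem_image.1 hk
    have h := hK y hy
    refine Finset.mem_filter.2 ⟨Finset.mem_range.2 (by omega), ?_⟩
    obtain ⟨m, rfl⟩ := han
    have hg := Nat.gcd_dvd_left (a * m - y) a
    have hg' := Nat.gcd_dvd_right (a * m - y) a
    have hy := (Nat.dvd_sub_iff_right (by omega) (hg'.mul_right m)).1 hg
    exact Nat.eq_one_of_dvd_coprimes h.2.1 hy hg'

theorem card_filter_coprime_le {n p r : ℕ} (hp : p.Prime) (hr : r.Prime) (hpr : p ≠ r)
    (hpn : p ∣ n) (hrn : r ∣ n) :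
    (((Finset.range n).filter (fun k => k.Coprime (p * r) ∧ 2 * k < n)).card : ℚ) ≤
      (1 - 1 / (p : ℚ)) * (1 - 1 / (r : ℚ)) * n / 2 := by
  have hcop : p.Coprime r := (Nat.coprime_primes hp hr).2 hpr
  have hdvd : p * r ∣ n := hcop.mul_dvd_of_dvd_of_dvd hpn hrn
  have h1 := two_mul_card_filter_coprime_le
    (fun h => hp.one_lt.ne' (Nat.eq_one_of_mul_eq_one_right h)) hdvd
  obtain ⟨m, rfl⟩ := hdvd
  rw [card_range_mul_filter_coprime, Nat.totient_mul hcop, Nat.totient_prime hp,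
    Nat.totient_prime hr] at h1
  have h2 := (Nat.cast_le (α := ℚ)).2 h1
  push_cast [hp.one_le, hr.one_le] at h2
  have hp0 : (p : ℚ) ≠ 0 := by exact_mod_cast hp.ne_zero
  have hr0 : (r : ℚ) ≠ 0 := by exact_mod_cast hr.ne_zero
  have h3 : (1 - 1 / (p : ℚ)) * (1 - 1 / (r : ℚ)) * ((p * r * m : ℕ) : ℚ) / 2 =
      m * ((p - 1) * (r - 1)) / 2 := by
    push_cast
    field_simp
  rw [h3]
  linarith

end Counting

section Covering

open scoped Pointwise

variable {F : Type*} [Field F]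

/-- A family of subgroups of `GL(V)` on which the determinant is surjective, not containing `SL(V)`
and whose conjugates cover `GL(V)`, gives a normal cover of any group between `SL` and `GL`. -/
theorem isNormalCover_of_family {n : ℕ} {ι : Type*} [Fintype ι]
    (H : ι → Subgroup ((Fin n → F) ≃ₗ[F] (Fin n → F)))
    (hdet : ∀ i (d : Fˣ), ∃ h ∈ H i, LinearEquiv.det h = d)
    (hproper : ∀ i, ∃ h, LinearEquiv.det h = 1 ∧ h ∉ H i)
    (hcover : ∀ g, ∃ i, ∃ e, e * g * e⁻¹ ∈ H i)
    (G : Subgroup (GL (Fin n) F)) (hG : SLinGL n F ≤ G) :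
    IsNormalCover G (Fintype.card ι) := by
  let Φ : GL (Fin n) F ≃* ((Fin n → F) ≃ₗ[F] (Fin n → F)) :=
    Matrix.GeneralLinearGroup.toLin.trans (LinearMap.GeneralLinearGroup.generalLinearEquiv F _)
  have hSL : ∀ e, LinearEquiv.det e = 1 → Φ.symm e ∈ G := by
    intro e he
    obtain ⟨g, rfl⟩ := Φ.surjective e
    have hg : (g : Matrix (Fin n) (Fin n) F).det = 1 := by
      have h := congrArg Units.val he
      rw [LinearEquiv.coe_det] at h
      exact (LinearMap.det_toLin' (g : Matrix (Fin n) (Fin n) F)).symm.trans h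
    rw [Φ.symm_apply_apply]
    exact hG ⟨⟨g, hg⟩, Units.ext rfl⟩
  let c := Fintype.equivFin ι
  refine ⟨fun i => ((H (c.symm i)).comap Φ.toMonoidHom).subgroupOf G, fun i htop => ?_, fun g => ?_⟩
  · obtain ⟨h, h1, hh⟩ := hproper (c.symm i)
    have : (⟨Φ.symm h, hSL h h1⟩ : G) ∈ ((H (c.symm i)).comap Φ.toMonoidHom).subgroupOf G := by
      rw [show ((H (c.symm i)).comap Φ.toMonoidHom).subgroupOf G = ⊤ from htop]
      exact Subgroup.mem_top _
    rw [Subgroup.mem_subgroupOf, Subgroup.mem_comap] at this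
    exact hh (by simpa using this)
  · obtain ⟨i, e, he⟩ := hcover (Φ g)
    obtain ⟨h, hh, hd⟩ := hdet i (LinearEquiv.det e)⁻¹
    have h1 : LinearEquiv.det (h * e) = 1 := by rw [map_mul, hd, inv_mul_cancel]
    refine ⟨c i, ⟨Φ.symm (h * e), hSL _ h1⟩, ?_⟩
    rw [Subgroup.mem_subgroupOf, Subgroup.mem_comap, c.symm_apply_apply]
    have h2 : h * (e * Φ g * e⁻¹) * h⁻¹ ∈ H i := mul_mem (mul_mem hh he) (inv_mem hh)
    simpa [mul_assoc] using h2

theorem exists_submodule_finrank_eq {V : Type*} [AddCommGroup V] [Module F V]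
    [FiniteDimensional F V] {k : ℕ} (hk : k ≤ Module.finrank F V) :
    ∃ W : Submodule F V, Module.finrank F W = k := by
  let b := Module.finBasis F V
  have := finrank_span_eq_card (b.linearIndependent.comp _ (Fin.castLE_injective hk))
  exact ⟨_, this.trans (Fintype.card_fin k)⟩

theorem exists_conj_mem_linearCommutant {V L : Type*} [AddCommGroup V] [Module F V]
    [FiniteDimensional F V] [Field L] [Algebra F L] [FiniteDimensional F L] [Finite F]
    (ρ : L →ₐ[F] Module.End F V) (g : V ≃ₗ[F] V)
    (h : ∀ π : Polynomial F, Irreducible π → π ∣ minpoly F (g : Module.End F V) →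
      Module.finrank F L ∣ π.natDegree) :
    ∃ e : V ≃ₗ[F] V, e * g * e⁻¹ ∈ linearCommutant ρ := by
  obtain ⟨ρ', hρ'⟩ := exists_algHom_commute (L := L) (g : Module.End F V) h
  obtain ⟨e, he⟩ := exists_conj_algHom ρ' ρ rfl
  refine ⟨e, fun a v => ?_⟩
  obtain ⟨w, rfl⟩ := e.surjective v
  have h1 : ∀ x, g (ρ' a x) = ρ' a (g x) := fun x => LinearMap.congr_fun (hρ' a) x
  simp [LinearEquiv.mul_apply, LinearEquiv.coe_inv, ← he, h1]

theorem exists_conj_mem_stabilizer {V : Type*} [AddCommGroup V] [Module F V]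
    [FiniteDimensional F V] (g : V ≃ₗ[F] V) {W U : Submodule F V}
    (hW : W ≤ W.comap (g : V →ₗ[F] V)) (h : Module.finrank F W = Module.finrank F U) :
    ∃ e : V ≃ₗ[F] V, e * g * e⁻¹ ∈ MulAction.stabilizer (V ≃ₗ[F] V) U := by
  obtain ⟨e, rfl⟩ := exists_smul_submodule_eq h
  refine ⟨e, ?_⟩
  rw [MulAction.mem_stabilizer_iff, mul_smul, mul_smul, inv_smul_smul,
    g.smul_submodule_eq_of_le_comap hW]

theorem isNormalCover_card_filter_coprime_add_two [Finite F] {n p r : ℕ} (hp : p.Prime)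
    (hr : r.Prime) (hpr : p ≠ r) (hn : 0 < n) (hpn : p ∣ n) (hrn : r ∣ n)
    (G : Subgroup (GL (Fin n) F)) (hG : SLinGL n F ≤ G) :
    IsNormalCover G
      (((Finset.range n).filter (fun k => k.Coprime (p * r) ∧ 2 * k < n)).card + 2) := by
  obtain ⟨ℓ, hℓ⟩ := CharP.exists F
  have : Fact ℓ.Prime := ⟨CharP.char_is_prime F ℓ⟩
  have : NeZero n := ⟨hn.ne'⟩
  have hext : ∀ s : ℕ, s.Prime → s ∣ n →
      ∃ H : Subgroup ((Fin n → F) ≃ₗ[F] (Fin n → F)),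
        (∀ d : Fˣ, ∃ h ∈ H, LinearEquiv.det h = d) ∧ (∃ h, LinearEquiv.det h = 1 ∧ h ∉ H) ∧
        ∀ g : (Fin n → F) ≃ₗ[F] (Fin n → F),
          (∀ π : Polynomial F, Irreducible π →
            π ∣ minpoly F (g : Module.End F (Fin n → F)) → s ∣ π.natDegree) →
          ∃ e, e * g * e⁻¹ ∈ H := by
    intro s hs hsn
    have : NeZero s := ⟨hs.ne_zero⟩
    have hL : Module.finrank F (FiniteField.Extension F ℓ s) = s :=
      FiniteField.finrank_extension F ℓ s
    obtain ⟨ρ⟩ := exists_algHom_end (F := F) (V := Fin n → F) (L := FiniteField.Extension F ℓ s)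
      (by rwa [hL, Module.finrank_fin_fun])
    exact ⟨linearCommutant ρ, exists_det_eq_mem_linearCommutant ρ,
      exists_det_eq_one_notMem_linearCommutant ρ (hL.symm ▸ hs.one_lt),
      fun g hg => exists_conj_mem_linearCommutant ρ g (hL.symm ▸ hg)⟩
  set K := (Finset.range n).filter (fun k => k.Coprime (p * r) ∧ 2 * k < n)
  have hsub : ∀ k : K, ∃ W : Submodule F (Fin n → F), Module.finrank F W = k := fun k =>
    exists_submodule_finrank_eq (by
      rw [Module.finrank_fin_fun]
      exact (Finset.mem_range.1 (Finset.mem_filter.1 k.2).1).le)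
  choose W hW using hsub
  have hWtop : ∀ k, W k ≠ ⊤ := by
    intro k h
    have h1 := hW k
    rw [h, finrank_top, Module.finrank_fin_fun] at h1
    have := Finset.mem_range.1 (Finset.mem_filter.1 k.2).1
    omega
  have hWbot : ∀ k, W k ≠ ⊥ := by
    intro k h
    have h1 := hW k
    rw [h, finrank_bot] at h1
    have h2 := (Finset.mem_filter.1 k.2).2.1
    rw [← h1, Nat.coprime_zero_left] at h2
    exact hp.one_lt.ne' (Nat.eq_one_of_mul_eq_one_right h2)
  obtain ⟨H₁, hdet₁, hproper₁, hconj₁⟩ := hext p hp hpn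
  obtain ⟨H₂, hdet₂, hproper₂, hconj₂⟩ := hext r hr hrn
  have hcard : Fintype.card (Option (Option K)) = K.card + 2 := by simp
  rw [← hcard]
  refine isNormalCover_of_family (fun i => i.elim H₁ fun j => j.elim H₂ fun k =>
    MulAction.stabilizer _ (W k)) ?_ ?_ ?_ G hG
  · rintro (_ | _ | k)
    exacts [hdet₁, hdet₂, exists_det_eq_mem_stabilizer (hWtop k)]
  · rintro (_ | _ | k)
    exacts [hproper₁, hproper₂, exists_det_eq_one_notMem_stabilizer (hWbot k) (hWtop k)]
  · intro g
    by_cases h₁ : ∀ π : Polynomial F, Irreducible π →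
        π ∣ minpoly F (g : Module.End F (Fin n → F)) → p ∣ π.natDegree
    · exact ⟨none, hconj₁ g h₁⟩
    by_cases h₂ : ∀ π : Polynomial F, Irreducible π →
        π ∣ minpoly F (g : Module.End F (Fin n → F)) → r ∣ π.natDegree
    · exact ⟨some none, hconj₂ g h₂⟩
    push Not at h₁ h₂
    obtain ⟨U, hU, hUc, hUn⟩ := exists_invariant_coprime (g : Module.End F (Fin n → F)) hp hr hpr
      (by rwa [Module.finrank_fin_fun]) (by rwa [Module.finrank_fin_fun]) h₁ h₂
    rw [Module.finrank_fin_fun] at hUn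
    have hk : Module.finrank F U ∈ K :=
      Finset.mem_filter.2 ⟨Finset.mem_range.2 (by omega), hUc, hUn⟩
    exact ⟨some (some ⟨_, hk⟩), exists_conj_mem_stabilizer g hU (hW ⟨_, hk⟩).symm⟩

end Covering

theorem gamma_le_two_smallest_primes_bound
    (n q : ℕ) (hn : 2 < n) (hq : IsPrimePow q) (hν : 2 ≤ nuPrimes n)
    (p₁ p₂ : ℕ) (hp₁ : p₁.Prime) (hp₂ : p₂.Prime) (hp₁n : p₁ ∣ n) (hp₂n : p₂ ∣ n)
    (hlt : p₁ < p₂)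
    (hsmallest : ∀ p : ℕ, p.Prime → p ∣ n → p = p₁ ∨ p₂ ≤ p)
    (F : Type*) [Field F] [Fintype F] (hF : Fintype.card F = q)
    (G : Subgroup (GL (Fin n) F)) (hG : SLinGL n F ≤ G) :
    (gammaCover G : ℚ) ≤ (1 - 1 / (p₁ : ℚ)) * (1 - 1 / (p₂ : ℚ)) * n / 2 + 2 := by
  refine le_trans ?_ (add_le_add_left (card_filter_coprime_le hp₁ hp₂ hlt.ne hp₁n hp₂n) 2)
  exact_mod_cast Nat.sInf_le (isNormalCover_card_filter_coprime_add_two hp₁ hp₂ hlt.ne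
    (by omega) hp₁n hp₂n G hG)
end

section
/- Let n > 6 be an integer, let ν(n) be the number of distinct prime divisors of n, and let q be a prime power. Let G be a group with SL_n(q) ≤ G ≤ GL_n(q). Then γ(G) ≤ ⌊n/3⌋ + φ(6,2,n) + ν(n). -/
open Polynomial

theorem exists_dvd_comp_pow_s1 {F : Type*} [Field F] [Finite F] {h : F[X]} (hh : Irreducible h)
    (χ : F[X]) (hχ : ∀ f, Irreducible f → f ∣ χ → h.natDegree ∣ f.natDegree) :
    χ ≠ 0 → ∃ (a : F[X]) (N : ℕ), χ ∣ (h.comp a) ^ N := by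
  induction χ using UniqueFactorizationMonoid.induction_on_coprime with
  | h0 => exact fun h ↦ absurd rfl h
  | h1 hx => exact fun _ ↦ ⟨0, 0, hx.dvd⟩
  | @hpr f i hf =>
    intro _
    obtain rfl | hi := eq_or_ne i 0
    · exact ⟨0, 0, by simp⟩
    have hirr := hf.irreducible
    have hdeg := hχ f hirr (dvd_pow_self f hi)
    have : Fact (Irreducible h) := ⟨hh⟩
    have : Fact (Irreducible f) := ⟨hirr⟩
    have : Module.Finite F (AdjoinRoot f) := (AdjoinRoot.powerBasis hirr.ne_zero).finite
    have : Finite (AdjoinRoot f) := Module.finite_of_finite F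
    obtain ⟨φ⟩ := FiniteField.nonempty_algHom_of_finrank_dvd (F := F) (K := AdjoinRoot h)
      (L := AdjoinRoot f) (by
        rw [(AdjoinRoot.powerBasis hh.ne_zero).finrank, (AdjoinRoot.powerBasis hirr.ne_zero).finrank]
        simpa using hdeg)
    obtain ⟨a, ha⟩ := AdjoinRoot.mk_surjective (φ (AdjoinRoot.root h))
    refine ⟨a, i, pow_dvd_pow_of_dvd ?_ i⟩
    have h0 : aeval (φ (AdjoinRoot.root h)) h = 0 := by
      rw [aeval_algHom_apply]; simp
    rw [← ha, ← AdjoinRoot.aeval_eq, ← aeval_comp, AdjoinRoot.aeval_eq] at h0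
    exact AdjoinRoot.mk_eq_zero.mp h0
  | @hcp x y hxy ihx ihy =>
    intro h0
    obtain ⟨a, N, ha⟩ := ihx (fun f hf hd ↦ hχ f hf (hd.mul_right y)) (left_ne_zero_of_mul h0)
    obtain ⟨b, M, hb⟩ := ihy (fun f hf hd ↦ hχ f hf (hd.mul_left x)) (right_ne_zero_of_mul h0)
    have hc := hxy.isCoprime
    obtain ⟨u, v, huv⟩ := id hc
    have key : ∀ (z c d : F[X]) (K L : ℕ), z ∣ d - c → z ∣ h.comp c ^ K → z ∣ h.comp d ^ (K + L) := by
      intro z c d K L hz hp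
      have h1 : z ∣ h.comp d ^ K - h.comp c ^ K := by
        refine (hz.trans ?_).trans (sub_dvd_pow_sub_pow _ _ K)
        simpa [comp, eval₂_eq_eval_map] using sub_dvd_eval_sub d c (h.map C)
      rw [pow_add]
      exact ((dvd_sub_left hp).mp h1).mul_right _
    refine ⟨a * (v * y) + b * (u * x), N + M, hc.mul_dvd ?_ ?_⟩
    · exact key x a _ N M ⟨(b - a) * u, by linear_combination a * huv⟩ ha
    · rw [add_comm N M]
      exact key y b _ M N ⟨(a - b) * v, by linear_combination b * huv⟩ hb

theorem exists_aeval_eq_zero_of_isNilpotent {F R : Type*} [Field F] [PerfectField F] [CommRing R]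
    [Algebra F R] {h : F[X]} (hh : Irreducible h) {r : R} (hr : IsNilpotent (aeval r h)) :
    ∃ s : R, aeval s h = 0 := by
  obtain ⟨u, v, huv⟩ := PerfectField.separable_of_irreducible hh
  have h1 := congr_arg (aeval r) huv
  simp only [map_add, map_mul, map_one] at h1
  have h2 : IsUnit (aeval r v * aeval r (derivative h)) := by
    rw [eq_sub_of_add_eq' h1]
    exact ((Commute.all _ _).isNilpotent_mul_left hr).isUnit_one_sub
  obtain ⟨s, ⟨-, hs⟩, -⟩ := existsUnique_nilpotent_sub_and_aeval_eq_zero hr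
    (isUnit_of_mul_isUnit_right h2)
  exact ⟨s, hs⟩

theorem exists_commute_aeval_eq_zero {F R : Type*} [Field F] [Finite F] [Ring R] [Algebra F R]
    {h χ : F[X]} (hh : Irreducible h)
    (hχ : ∀ f, Irreducible f → f ∣ χ → h.natDegree ∣ f.natDegree) (h0 : χ ≠ 0)
    {g : R} (hg : aeval g χ = 0) : ∃ A : R, aeval A h = 0 ∧ Commute g A := by
  obtain ⟨a, N, c, hc⟩ := exists_dvd_comp_pow_s1 hh χ hχ h0
  have := Algebra.isMulCommutative_adjoin F (s := {g}) (by simp)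
  let : CommRing (Algebra.adjoin F {g}) :=
    { (inferInstance : Ring (Algebra.adjoin F {g})) with mul_comm := mul_comm' }
  let x : Algebra.adjoin F {g} := ⟨g, Algebra.self_mem_adjoin_singleton F g⟩
  have hr : IsNilpotent (aeval (aeval x a) h) := by
    refine ⟨N, Subtype.ext ?_⟩
    rw [← aeval_comp, ← map_pow, hc, map_mul]
    have : aeval x χ = 0 := Subtype.ext (by
      rw [← Subalgebra.coe_val, ← aeval_algHom_apply]; simpa [x] using hg)
    simp [this]
  obtain ⟨s, hs⟩ := exists_aeval_eq_zero_of_isNilpotent hh hr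
  refine ⟨s, ?_, congr_arg Subtype.val (mul_comm x s)⟩
  have := congr_arg (Subalgebra.val _) hs
  rwa [← aeval_algHom_apply, map_zero] at this

theorem dvd_minpoly_of_dvd_charpoly {F ι : Type*} [Field F] [Fintype ι] [DecidableEq ι]
    (A : Matrix ι ι F) {f : F[X]} (hf : Irreducible f) (hd : f ∣ A.charpoly) :
    f ∣ minpoly F A := by
  have : Fact (Irreducible f) := ⟨hf⟩
  let B := A.map (algebraMap F (AdjoinRoot f))
  have hroot : B.charpoly.IsRoot (AdjoinRoot.root f) := by
    obtain ⟨c, hc⟩ := hd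
    rw [Matrix.charpoly_map, hc, Polynomial.map_mul, IsRoot, eval_mul, eval_map_algebraMap,
      AdjoinRoot.aeval_eq, AdjoinRoot.mk_self, zero_mul]
  have hev : Module.End.HasEigenvalue (Matrix.toLin' B) (AdjoinRoot.root f) := by
    rw [Module.End.hasEigenvalue_iff_isRoot_charpoly]; simpa using hroot
  obtain ⟨v, hv⟩ := hev.exists_hasEigenvector
  have h0 : aeval B ((minpoly F A).map (algebraMap F (AdjoinRoot f))) = 0 := by
    have := congr_arg (Algebra.ofId F (AdjoinRoot f)).mapMatrix (minpoly.aeval F A)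
    rw [← aeval_algHom_apply, map_zero] at this
    rw [aeval_map_algebraMap]
    exact this
  have h1 := Module.End.aeval_apply_of_hasEigenvector
    (p := (minpoly F A).map (algebraMap F (AdjoinRoot f))) hv
  have h2 : aeval (Matrix.toLin' B) ((minpoly F A).map (algebraMap F (AdjoinRoot f))) = 0 := by
    have := congr_arg Matrix.toLinAlgEquiv' h0
    rw [← aeval_algHom_apply, map_zero] at this
    exact this
  rw [h2, LinearMap.zero_apply, eq_comm, smul_eq_zero_iff_left hv.2, eval_map_algebraMap,
    AdjoinRoot.aeval_eq] at h1
  exact AdjoinRoot.mk_eq_zero.mp h1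

theorem exists_invariant_of_dvd_minpoly {F V : Type*} [Field F] [AddCommGroup V] [Module F V]
    [FiniteDimensional F V]
    (T : Module.End F V) {f : F[X]} (hf : Irreducible f) (hd : f ∣ minpoly F T) :
    ∃ W : Submodule F V, Module.finrank F W = f.natDegree ∧ W.map T ≤ W := by
  obtain ⟨r, hr⟩ := hd
  have hT : IsIntegral F T := Algebra.IsIntegral.isIntegral T
  have hr0 : r ≠ 0 := right_ne_zero_of_mul (hr ▸ minpoly.ne_zero hT)
  have hrT : aeval T r ≠ 0 := by
    intro h
    obtain ⟨c, hc⟩ := minpoly.dvd F T h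
    apply hf.not_isUnit
    refine IsUnit.of_mul_eq_one c (mul_right_cancel₀ hr0 ?_)
    rw [one_mul]
    linear_combination -c * hr - hc
  obtain ⟨w, hw⟩ : ∃ w, aeval T r w ≠ 0 := by
    by_contra! h
    exact hrT (LinearMap.ext h)
  set v := aeval T r w with hv
  have hfv : aeval T f v = 0 := by
    rw [hv, ← Module.End.mul_apply, ← map_mul, ← hr, minpoly.aeval, LinearMap.zero_apply]
  let L : F[X] →ₗ[F] V := LinearMap.applyₗ v ∘ₗ (aeval T).toLinearMap
  have hL : ∀ p, L p = aeval T p v := fun _ ↦ rfl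
  refine ⟨(degreeLT F f.natDegree).map L, ?_, ?_⟩
  · rw [← LinearMap.range_domRestrict, LinearMap.finrank_range_of_inj,
      (degreeLTEquiv F f.natDegree).finrank_eq, Module.finrank_fin_fun]
    rw [← LinearMap.ker_eq_bot, LinearMap.ker_eq_bot']
    rintro ⟨p, hp⟩ hp0
    rw [LinearMap.domRestrict_apply, hL] at hp0
    by_contra hne
    have hnd : ¬ f ∣ p := fun hfp ↦ hne <| Subtype.ext <| eq_zero_of_dvd_of_degree_lt hfp <| by
      rwa [degree_eq_natDegree hf.ne_zero, ← mem_degreeLT]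
    obtain ⟨a, b, hab⟩ := (hf.coprime_iff_not_dvd).mpr hnd
    have h1 := LinearMap.congr_fun (congr_arg (aeval T) hab) v
    rw [map_add, map_mul, map_mul, LinearMap.add_apply, Module.End.mul_apply, Module.End.mul_apply,
      hfv, hp0, map_zero, map_zero, add_zero, map_one, Module.End.one_apply] at h1
    exact hw h1.symm
  · rintro - ⟨-, ⟨p, hp, rfl⟩, rfl⟩
    refine ⟨(X * p) % f, ?_, ?_⟩
    · rw [SetLike.mem_coe, mem_degreeLT, ← degree_eq_natDegree hf.ne_zero]
      exact degree_mod_lt _ hf.ne_zero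
    · have h2 : (X * p) % f = X * p - f * (X * p / f) := by
        rw [eq_sub_iff_add_eq, EuclideanDomain.mod_add_div]
      rw [hL, h2, map_sub, mul_comm f, map_mul, map_mul, LinearMap.sub_apply, Module.End.mul_apply,
        Module.End.mul_apply, hfv, hL]
      simp

theorem exists_prime_dvd_natDegree_of_forall_not {F : Type*} [Field F] {χ : F[X]} {n : ℕ}
    (hn : 2 < n) (hχ : χ.natDegree = n)
    (hD : ∀ f, Irreducible f → f ∣ χ → n < 3 * f.natDegree ∧
      (f.natDegree.Coprime n → n ≤ 2 * f.natDegree)) :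
    ∃ p, p.Prime ∧ p ∣ n ∧ ∀ f, Irreducible f → f ∣ χ → p ∣ f.natDegree := by
  have h0 : χ ≠ 0 := by rintro rfl; simp at hχ; omega
  have hex : ∀ r : F[X], r ≠ 0 → ¬IsUnit r → ∃ f, Irreducible f ∧ f ∣ r := fun r hr hu ↦
    WfDvdMonoid.exists_irreducible_factor hu hr
  have hu : ¬ IsUnit χ := fun h ↦ by have := natDegree_eq_zero_of_isUnit h; omega
  obtain ⟨f, ⟨hf, hfχ⟩, hmin⟩ :=
    exists_minimalFor_of_wellFoundedLT (fun f : F[X] ↦ Irreducible f ∧ f ∣ χ) natDegree (hex χ h0 hu)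
  replace hmin : ∀ g, Irreducible g → g ∣ χ → f.natDegree ≤ g.natDegree := fun g hg hgd ↦ by
    by_contra! h
    exact absurd (hmin ⟨hg, hgd⟩ h.le) (by omega)
  obtain ⟨h3, hc⟩ := hD f hf hfχ
  obtain ⟨r, rfl⟩ := id hfχ
  have hr0 := right_ne_zero_of_mul h0
  have hdeg_le : ∀ s : F[X], ¬ IsUnit s → s ∣ f * r → f.natDegree ≤ s.natDegree := by
    intro s hs hsd
    have hs0 : s ≠ 0 := ne_zero_of_dvd_ne_zero h0 hsd
    obtain ⟨g, hg, hgs⟩ := hex s hs0 hs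
    exact (hmin g hg (hgs.trans hsd)).trans (natDegree_le_of_dvd hgs hs0)
  have hassoc : ∀ {g s : F[X]}, Irreducible g → Irreducible s → g ∣ s →
      g.natDegree = s.natDegree := fun hg hs h ↦
    natDegree_eq_of_degree_eq (degree_eq_degree_of_associated (hg.associated_of_dvd hs h))
  rw [natDegree_mul hf.ne_zero hr0] at hχ
  by_cases hr : IsUnit r
  · have hr' := natDegree_eq_zero_of_isUnit hr
    refine ⟨n.minFac, Nat.minFac_prime (by omega), n.minFac_dvd, fun g hg hgd ↦ ?_⟩
    rw [hassoc hg hf (hr.dvd_mul_right.mp hgd), show f.natDegree = n by omega]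
    exact n.minFac_dvd
  · have hri : Irreducible r := by
      refine ⟨hr, fun a b hab ↦ ?_⟩
      by_contra! h
      have ha := hdeg_le a h.1 (hab ▸ dvd_mul_of_dvd_right (dvd_mul_right a b) f)
      have hb := hdeg_le b h.2 (hab ▸ dvd_mul_of_dvd_right (dvd_mul_left b a) f)
      have := hab ▸ natDegree_mul (left_ne_zero_of_mul (hab ▸ hr0))
        (right_ne_zero_of_mul (hab ▸ hr0))
      omega
    have hfr := hdeg_le r hr (dvd_mul_left r f)
    have hnc : ¬ f.natDegree.Coprime n := by
      intro h
      have h2 : n = 2 * f.natDegree := by have := hc h; omega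
      have := Nat.Coprime.eq_one_of_dvd h (h2 ▸ dvd_mul_left _ _)
      omega
    obtain ⟨p, hp, hpd, hpn⟩ := Nat.Prime.not_coprime_iff_dvd.mp hnc
    refine ⟨p, hp, hpn, fun g hg hgd ↦ ?_⟩
    obtain h | h := hg.prime.dvd_or_dvd hgd
    · rwa [hassoc hg hf h]
    · rw [hassoc hg hri h]
      exact (Nat.dvd_add_right hpd).mp (hχ ▸ hpn)

section Linear
variable {F V : Type*} [Field F] [AddCommGroup V] [Module F V] [FiniteDimensional F V]

theorem exists_linearEquiv_det_eq_of_ne_zero {w : V} (hw : w ≠ 0) {c : F} (hc : c ≠ 0) :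
    ∃ D : V ≃ₗ[F] V, LinearMap.det (D : V →ₗ[F] V) = c ∧ ∀ x, D x - x ∈ Submodule.span F {w} := by
  obtain ⟨f, hf, -⟩ := Submodule.exists_le_ker_of_notMem (p := (⊥ : Submodule F V)) (v := w) (by simpa)
  have hdet : (LinearMap.transvection (((c - 1) / f w) • f) w).det = c := by
    rw [LinearMap.transvection.det]; simp [hf]
  have hcoe : (LinearMap.equivOfDetNeZero _ (hdet.symm ▸ hc) : V →ₗ[F] V) =
      LinearMap.transvection (((c - 1) / f w) • f) w := LinearMap.ext fun _ ↦ rfl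
  refine ⟨LinearMap.equivOfDetNeZero _ (hdet.symm ▸ hc), by rw [hcoe, hdet], fun x ↦ ?_⟩
  refine Submodule.mem_span_singleton.mpr ⟨(((c - 1) / f w) • f) x, ?_⟩
  change _ = LinearMap.transvection (((c - 1) / f w) • f) w x - x
  rw [LinearMap.transvection.apply, add_sub_cancel_left]

theorem Submodule.exists_linearEquiv_map_eq {W₁ W₂ : Submodule F V}
    (h : Module.finrank F W₁ = Module.finrank F W₂) :
    ∃ e : V ≃ₗ[F] V, W₁.map (e : V →ₗ[F] V) = W₂ := by
  obtain ⟨C₁, hC₁⟩ := W₁.exists_isCompl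
  obtain ⟨C₂, hC₂⟩ := W₂.exists_isCompl
  have hC : Module.finrank F C₁ = Module.finrank F C₂ := by
    have h1 := Submodule.finrank_add_eq_of_isCompl hC₁
    have h2 := Submodule.finrank_add_eq_of_isCompl hC₂
    omega
  let e₁ := LinearEquiv.ofFinrankEq W₁ W₂ h
  let e₂ := LinearEquiv.ofFinrankEq C₁ C₂ hC
  let e := (Submodule.prodEquivOfIsCompl W₁ C₁ hC₁).symm ≪≫ₗ (e₁.prodCongr e₂) ≪≫ₗ
    Submodule.prodEquivOfIsCompl W₂ C₂ hC₂
  refine ⟨e, Submodule.eq_of_le_of_finrank_eq ?_ ?_⟩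
  · rintro - ⟨x, hx, rfl⟩
    have : e x = e₁ ⟨x, hx⟩ := by
      simp [e, Submodule.prodEquivOfIsCompl_symm_apply_left W₁ C₁ hC₁ ⟨x, hx⟩]
    rw [LinearEquiv.coe_coe, this]
    exact (e₁ ⟨x, hx⟩).2
  · rw [← h]; exact LinearEquiv.finrank_map_eq e W₁

theorem Submodule.exists_det_eq_one_map_eq {W₁ W₂ : Submodule F V}
    (h : Module.finrank F W₁ = Module.finrank F W₂) (h0 : W₁ ≠ ⊥) :
    ∃ e : V ≃ₗ[F] V, LinearMap.det (e : V →ₗ[F] V) = 1 ∧ W₁.map (e : V →ₗ[F] V) = W₂ := by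
  obtain ⟨e, he⟩ := Submodule.exists_linearEquiv_map_eq h
  obtain ⟨w, hw, hw0⟩ := Submodule.exists_mem_ne_zero_of_ne_bot h0
  have hdet : LinearMap.det (e : V →ₗ[F] V) ≠ 0 := e.isUnit_det'.ne_zero
  obtain ⟨D, hD, hDw⟩ := exists_linearEquiv_det_eq_of_ne_zero hw0 (inv_ne_zero hdet)
  refine ⟨D ≪≫ₗ e, ?_, ?_⟩
  · rw [LinearEquiv.coe_trans, LinearMap.det_comp, hD, mul_inv_cancel₀ hdet]
  · rw [LinearEquiv.coe_trans, Submodule.map_comp, ← he]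
    congr 1
    refine Submodule.eq_of_le_of_finrank_eq ?_ (LinearEquiv.finrank_map_eq D W₁)
    rintro - ⟨x, hx, rfl⟩
    have := (Submodule.span_singleton_le_iff_mem w W₁).mpr hw (hDw x)
    simpa using W₁.add_mem this hx

theorem Submodule.exists_det_eq_one_map_ne {W : Submodule F V} (h0 : W ≠ ⊥) (h1 : W ≠ ⊤) :
    ∃ e : V ≃ₗ[F] V, LinearMap.det (e : V →ₗ[F] V) = 1 ∧ W.map (e : V →ₗ[F] V) ≠ W := by
  obtain ⟨w, hw, hw0⟩ := Submodule.exists_mem_ne_zero_of_ne_bot h0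
  obtain ⟨v, -, hv⟩ := SetLike.exists_of_lt h1.lt_top
  have hwv : w ∉ Submodule.span F {v} := by
    intro h
    obtain ⟨c, rfl⟩ := Submodule.mem_span_singleton.mp h
    have hc : c ≠ 0 := by rintro rfl; simp at hw0
    exact hv ((Submodule.smul_mem_iff W hc).mp hw)
  obtain ⟨f, hf, hfv⟩ := Submodule.exists_le_ker_of_notMem hwv
  have hfv : f v = 0 := hfv (Submodule.mem_span_singleton_self v)
  refine ⟨LinearEquiv.transvection hfv, ?_, fun h ↦ hv ?_⟩
  · rw [LinearEquiv.transvection.coe_toLinearMap, LinearMap.transvection.det, hfv, add_zero]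
  · have := h ▸ Submodule.mem_map_of_mem (f := (LinearEquiv.transvection hfv : V →ₗ[F] V)) hw
    rw [LinearEquiv.transvection.coe_toLinearMap, LinearMap.transvection.apply,
      Submodule.add_mem_iff_right _ hw, Submodule.smul_mem_iff _ hf] at this
    exact this

end Linear

section Ext
variable {F K M N : Type*} [Field F] [Field K] [Finite K] [Algebra F K] [AddCommGroup M]
  [Module F M] [Module K M] [IsScalarTower F K M] [FiniteDimensional F M]
  [AddCommGroup N] [Module F N] [Module K N] [IsScalarTower F K N]

theorem exists_linearEquiv_det_comp_eq_one [Nontrivial M] (e : M ≃ₗ[F] N) :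
    ∃ T : M ≃ₗ[K] N,
      LinearMap.det ((e.symm : N →ₗ[F] M) ∘ₗ (T.restrictScalars F : M →ₗ[F] N)) = 1 := by
  have : FiniteDimensional F N := e.finiteDimensional
  have : FiniteDimensional F K := Module.Finite.of_finite
  have : FiniteDimensional K M := .right F K M
  have : FiniteDimensional K N := .right F K N
  have hKM : Module.finrank K M = Module.finrank K N := by
    refine Nat.eq_of_mul_eq_mul_left (Module.finrank_pos (R := F) (M := K)) ?_
    rw [Module.finrank_mul_finrank, Module.finrank_mul_finrank, e.finrank_eq]
  let T := LinearEquiv.ofFinrankEq M N hKM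
  have hdet : LinearMap.det ((e.symm : N →ₗ[F] M) ∘ₗ (T.restrictScalars F : M →ₗ[F] N)) ≠ 0 := by
    rw [← LinearEquiv.coe_trans]
    exact (LinearEquiv.isUnit_det' _).ne_zero
  obtain ⟨α, hα⟩ := FiniteField.norm_surjective F K (LinearMap.det
    ((e.symm : N →ₗ[F] M) ∘ₗ (T.restrictScalars F : M →ₗ[F] N)))⁻¹
  have hα0 : α ≠ 0 := by rintro rfl; rw [Algebra.norm_zero] at hα; exact inv_ne_zero hdet hα.symm
  obtain ⟨w, hw⟩ := exists_ne (0 : M)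
  obtain ⟨D, hD, -⟩ := exists_linearEquiv_det_eq_of_ne_zero hw hα0
  refine ⟨D ≪≫ₗ T, ?_⟩
  have : (((D ≪≫ₗ T).restrictScalars F : M ≃ₗ[F] N) : M →ₗ[F] N) =
    (T.restrictScalars F : M →ₗ[F] N) ∘ₗ (D : M →ₗ[K] M).restrictScalars F := rfl
  rw [this, ← LinearMap.comp_assoc, LinearMap.det_comp, LinearMap.det_restrictScalars, hD, hα,
    mul_inv_cancel₀ hdet]

end Ext

/-- The space `V` viewed as a module over `K` through a representation `ρ` of `K` on `V`. -/
def RepModule {F K V : Type*} [Field F] [Field K] [Algebra F K] [AddCommGroup V] [Module F V]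
    (_ : K →ₐ[F] Module.End F V) : Type _ := V

namespace RepModule
variable {F K V : Type*} [Field F] [Field K] [Algebra F K] [AddCommGroup V] [Module F V]
    (ρ : K →ₐ[F] Module.End F V)

instance : AddCommGroup (RepModule ρ) := inferInstanceAs (AddCommGroup V)
instance : Module F (RepModule ρ) := inferInstanceAs (Module F V)
instance : Module K (RepModule ρ) := Module.compHom V ρ.toRingHom

instance : IsScalarTower F K (RepModule ρ) where
  smul_assoc c k v := LinearMap.congr_fun (map_smul ρ c k) (id v : V)

instance [FiniteDimensional F V] : FiniteDimensional F (RepModule ρ) :=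
  inferInstanceAs (FiniteDimensional F V)
instance [Nontrivial V] : Nontrivial (RepModule ρ) := inferInstanceAs (Nontrivial V)

end RepModule

theorem exists_det_eq_one_comp_algHom_eq {F K V : Type*} [Field F] [Field K] [Finite K]
    [Algebra F K] [AddCommGroup V] [Module F V] [FiniteDimensional F V] [Nontrivial V]
    (ρ σ : K →ₐ[F] Module.End F V) :
    ∃ e : V ≃ₗ[F] V, LinearMap.det (e : V →ₗ[F] V) = 1 ∧
      ∀ k, (e : V →ₗ[F] V) ∘ₗ ρ k = σ k ∘ₗ (e : V →ₗ[F] V) := by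
  let i : RepModule ρ ≃ₗ[F] RepModule σ := LinearEquiv.refl F V
  obtain ⟨T, hT⟩ := exists_linearEquiv_det_comp_eq_one (K := K) i
  exact ⟨T.restrictScalars F, hT, fun k ↦ LinearMap.ext fun v ↦ T.map_smul k v⟩

theorem exists_det_eq_one_comp_eq {F V : Type*} [Field F] [Finite F] [AddCommGroup V] [Module F V]
    [FiniteDimensional F V] [Nontrivial V] {h : F[X]} (hh : Irreducible h) {A B : Module.End F V}
    (hA : aeval A h = 0) (hB : aeval B h = 0) :
    ∃ e : V ≃ₗ[F] V, LinearMap.det (e : V →ₗ[F] V) = 1 ∧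
      (e : V →ₗ[F] V) ∘ₗ A = B ∘ₗ (e : V →ₗ[F] V) := by
  have : Fact (Irreducible h) := ⟨hh⟩
  have : Module.Finite F (AdjoinRoot h) := (AdjoinRoot.powerBasis hh.ne_zero).finite
  have : Finite (AdjoinRoot h) := Module.finite_of_finite F
  let ρ (A : Module.End F V) (hA : aeval A h = 0) : AdjoinRoot h →ₐ[F] Module.End F V :=
    Ideal.Quotient.liftₐ (Ideal.span {h}) (aeval A) fun a ha ↦ by
      obtain ⟨c, rfl⟩ := Ideal.mem_span_singleton.mp ha
      rw [map_mul, hA, zero_mul]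
  have hρ : ∀ A hA, ρ A hA (AdjoinRoot.root h) = A := fun A hA ↦ aeval_X A
  obtain ⟨e, he, hc⟩ := exists_det_eq_one_comp_algHom_eq (ρ A hA) (ρ B hB)
  exact ⟨e, he, by simpa only [hρ] using hc (AdjoinRoot.root h)⟩

section GroupAction
variable {Γ X : Type*} [Group Γ]

theorem exists_proper_subgroup_conj_mem [MulAction Γ X] {S G : Subgroup Γ} (hSG : S ≤ G)
    [Nontrivial G] (C : Set X) (htrans : ∀ x ∈ C, ∀ y ∈ C, ∃ s ∈ S, s • x = y)
    (hmove : ∀ x ∈ C, ∃ s ∈ S, s • x ≠ x) :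
    ∃ H : Subgroup G, H ≠ ⊤ ∧
      ∀ g : G, (∃ x ∈ C, (g : Γ) • x = x) → ∃ y : G, y * g * y⁻¹ ∈ H := by
  obtain rfl | ⟨x, hx⟩ := C.eq_empty_or_nonempty
  · exact ⟨⊥, bot_ne_top, by simp⟩
  refine ⟨MulAction.stabilizer G x, fun htop ↦ ?_, fun g ⟨y, hy, hgy⟩ ↦ ?_⟩
  · obtain ⟨s, hs, hsx⟩ := hmove x hx
    have : (⟨s, hSG hs⟩ : G) ∈ MulAction.stabilizer G x := htop ▸ Subgroup.mem_top _
    exact hsx this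
  · obtain ⟨s, hs, hsy⟩ := htrans y hy x hx
    refine ⟨⟨s, hSG hs⟩, ?_⟩
    rw [MulAction.mem_stabilizer_iff, Subgroup.smul_def]
    have : s⁻¹ • x = y := by rw [← hsy, inv_smul_smul]
    simp [mul_smul, this, hgy, hsy]

end GroupAction

section GeneralLinear
variable {n : ℕ} {F : Type*} [Field F]

theorem exists_mem_SLinGL_toLin'_eq (e : (Fin n → F) ≃ₗ[F] (Fin n → F))
    (he : LinearMap.det (e : (Fin n → F) →ₗ[F] (Fin n → F)) = 1) :
    ∃ s ∈ SLinGL n F, Matrix.toLin' (s : Matrix (Fin n) (Fin n) F) = e :=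
  ⟨_, ⟨⟨LinearMap.toMatrix' e, by rw [LinearMap.det_toMatrix', he]⟩, rfl⟩, Matrix.toLin'_toMatrix' _⟩

theorem exists_proper_subgroup_of_finrank {G : Subgroup (GL (Fin n) F)} (hG : SLinGL n F ≤ G)
    [Nontrivial G] {k : ℕ} (h0 : 0 < k) (hk : k < n) :
    ∃ H : Subgroup G, H ≠ ⊤ ∧ ∀ g : G, (∃ W : Submodule F (Fin n → F), Module.finrank F W = k ∧
      W.map (Matrix.toLin' (g : GL (Fin n) F).val) ≤ W) → ∃ y : G, y * g * y⁻¹ ∈ H := by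
  let : MulAction (GL (Fin n) F) (Submodule F (Fin n → F)) :=
    { smul := fun g W ↦ W.map (Matrix.toLin' g.val)
      one_smul := fun W ↦ by
        change W.map (Matrix.toLin' 1) = W
        rw [Matrix.toLin'_one, Submodule.map_id]
      mul_smul := fun g h W ↦ by
        change W.map (Matrix.toLin' (g.val * h.val)) = (W.map _).map _
        rw [Matrix.toLin'_mul, Submodule.map_comp] }
  have hsmul : ∀ (g : GL (Fin n) F) (W : Submodule F (Fin n → F)),
    g • W = W.map (Matrix.toLin' g.val) := fun _ _ ↦ rfl
  have hbot : ∀ W : Submodule F (Fin n → F), Module.finrank F W = k → W ≠ ⊥ := by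
    rintro - hW rfl
    rw [finrank_bot] at hW
    omega
  obtain ⟨H, hH, hconj⟩ := exists_proper_subgroup_conj_mem hG
    {W : Submodule F (Fin n → F) | Module.finrank F W = k} (fun W hW W' hW' ↦ by
      obtain ⟨e, he, hmap⟩ := Submodule.exists_det_eq_one_map_eq (hW.trans hW'.symm) (hbot W hW)
      obtain ⟨s, hs, hse⟩ := exists_mem_SLinGL_toLin'_eq e he
      exact ⟨s, hs, by rw [hsmul, hse, hmap]⟩) (fun W hW ↦ by
      have htop : W ≠ ⊤ := by
        rintro rfl
        rw [Set.mem_ofPred_eq, finrank_top, Module.finrank_fin_fun] at hW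
        omega
      obtain ⟨e, he, hmap⟩ := Submodule.exists_det_eq_one_map_ne (hbot W hW) htop
      obtain ⟨s, hs, hse⟩ := exists_mem_SLinGL_toLin'_eq e he
      exact ⟨s, hs, by rwa [hsmul, hse]⟩)
  refine ⟨H, hH, fun g ⟨W, hW, hgW⟩ ↦ hconj g ⟨W, hW, Submodule.eq_of_le_of_finrank_eq hgW ?_⟩⟩
  have hinv : Function.LeftInverse (Matrix.toLin' (g : GL (Fin n) F)⁻¹.val)
      (Matrix.toLin' (g : GL (Fin n) F).val) := fun v ↦ by
    rw [← LinearMap.comp_apply, ← Matrix.toLin'_mul, Units.inv_mul, Matrix.toLin'_one,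
      LinearMap.id_apply]
  exact (Submodule.equivMapOfInjective _ hinv.injective W).finrank_eq.symm

theorem exists_proper_subgroup_of_irreducible [Finite F] {G : Subgroup (GL (Fin n) F)}
    (hG : SLinGL n F ≤ G) [Nontrivial G] {h : F[X]} (hh : Irreducible h) (hdeg : h.natDegree ≠ 1)
    (hn : 0 < n) :
    ∃ H : Subgroup G, H ≠ ⊤ ∧ ∀ g : G, (∃ A : Matrix (Fin n) (Fin n) F, aeval A h = 0 ∧
      Commute (g : GL (Fin n) F).val A) → ∃ y : G, y * g * y⁻¹ ∈ H := by
  have : NeZero n := ⟨hn.ne'⟩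
  let conj : MulAction (GL (Fin n) F) (Matrix (Fin n) (Fin n) F) :=
    { smul := fun g A ↦ g.val * A * g⁻¹.val
      one_smul := fun A ↦ by
        change (1 : GL (Fin n) F).val * A * (1 : GL (Fin n) F)⁻¹.val = A
        simp
      mul_smul := fun g h A ↦ by
        change (g * h).val * A * (g * h)⁻¹.val = g.val * (h.val * A * h⁻¹.val) * g⁻¹.val
        simp only [mul_inv_rev, Units.val_mul, mul_assoc] }
  have hsmul : ∀ (g : GL (Fin n) F) (A B : Matrix (Fin n) (Fin n) F),
      conj.smul g A = B ↔ g.val * A = B * g.val := fun g A B ↦ by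
    change g.val * A * g⁻¹.val = B ↔ _
    exact Units.mul_inv_eq_iff_eq_mul g
  have haeval : ∀ A : Matrix (Fin n) (Fin n) F, aeval A h = 0 → aeval (Matrix.toLin' A) h = 0 := by
    intro A hA
    have := congr_arg Matrix.toLinAlgEquiv' hA
    rwa [← aeval_algHom_apply, map_zero] at this
  obtain ⟨H, hH, hconj⟩ := exists_proper_subgroup_conj_mem hG
    {A : Matrix (Fin n) (Fin n) F | aeval A h = 0} (fun A hA B hB ↦ by
      obtain ⟨e, he, hcomp⟩ := exists_det_eq_one_comp_eq hh (haeval A hA) (haeval B hB)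
      obtain ⟨s, hs, hse⟩ := exists_mem_SLinGL_toLin'_eq e he
      refine ⟨s, hs, (hsmul s A B).mpr (Matrix.toLin'.injective ?_)⟩
      rw [Matrix.toLin'_mul, Matrix.toLin'_mul, hse]
      exact hcomp) (fun A hA ↦ by
      by_contra! hfix
      obtain ⟨c, rfl⟩ := Matrix.mem_range_scalar_of_commute_transvectionStruct (M := A) fun t ↦
        (hsmul _ A A).mp (hfix _ ⟨⟨t.toMatrix, t.det⟩, rfl⟩)
      rw [Set.mem_ofPred_eq] at hA
      have hc : h.IsRoot c := by
        have h1 : aeval (algebraMap F (Matrix (Fin n) (Fin n) F) c) h = 0 := hA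
        rwa [aeval_algebraMap_apply, map_eq_zero_iff _ (algebraMap F _).injective,
          coe_aeval_eq_eval] at h1
      exact hdeg (natDegree_eq_of_degree_eq_some (degree_eq_one_of_irreducible_of_root hh hc)))
  exact ⟨H, hH, fun g ⟨A, hA, hgA⟩ ↦ hconj g ⟨A, hA, (hsmul _ A A).mpr hgA.eq⟩⟩

end GeneralLinear

theorem gammaCover_le_card {G ι : Type*} [Group G] [Fintype ι] (P : ι → G → Prop)
    (hH : ∀ i, ∃ H : Subgroup G, H ≠ ⊤ ∧ ∀ g, P i g → ∃ y, y * g * y⁻¹ ∈ H)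
    (hP : ∀ g, ∃ i, P i g) : gammaCover G ≤ Fintype.card ι := by
  choose H hne hconj using hH
  refine Nat.sInf_le ⟨fun j ↦ H ((Fintype.equivFin ι).symm j), fun j ↦ hne _, fun g ↦ ?_⟩
  obtain ⟨i, hi⟩ := hP g
  obtain ⟨y, hy⟩ := hconj i g hi
  exact ⟨Fintype.equivFin ι i, y, by simpa using hy⟩

theorem exists_irreducible_natDegree_eq (F : Type*) [Field F] [Finite F] {p : ℕ} (hp : p ≠ 0) :
    ∃ h : F[X], Irreducible h ∧ h.natDegree = p := by
  have : NeZero p := ⟨hp⟩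
  obtain ⟨c, _⟩ := CharP.exists F
  have : Fact c.Prime := ⟨CharP.char_is_prime F c⟩
  obtain ⟨α, hα⟩ := Field.exists_primitive_element F (FiniteField.Extension F c p)
  have hint : IsIntegral F α := Algebra.IsIntegral.isIntegral α
  refine ⟨minpoly F α, minpoly.irreducible hint, ?_⟩
  rw [← IntermediateField.adjoin.finrank hint, hα, IntermediateField.finrank_top',
    FiniteField.finrank_extension]

theorem gamma_le_floor_third_bound
    (n q : ℕ) (hn : 6 < n) (hq : IsPrimePow q)
    (F : Type*) [Field F] [Fintype F] (hF : Fintype.card F = q)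
    (G : Subgroup (GL (Fin n) F)) (hG : SLinGL n F ≤ G) :
    gammaCover G ≤ n / 3 + partialTotient 6 2 n + nuPrimes n := by
  have : NeZero n := ⟨by omega⟩
  have : Nontrivial G := by
    let t : Matrix.TransvectionStruct (Fin n) F :=
      ⟨⟨0, by omega⟩, ⟨1, by omega⟩, by simp, 1⟩
    let s : Matrix.SpecialLinearGroup (Fin n) F := ⟨t.toMatrix, t.det⟩
    refine nontrivial_of_ne ⟨_, hG ⟨s, rfl⟩⟩ 1 fun h ↦ ?_
    have h1 : t.toMatrix = 1 := congr_arg (fun g : G ↦ (g : GL (Fin n) F).val) h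
    have h2 := congr_fun₂ h1 ⟨0, by omega⟩ ⟨1, by omega⟩
    simp [t, Matrix.TransvectionStruct.toMatrix, Matrix.transvection, Matrix.one_apply] at h2
  let D : Finset ℕ := (Finset.range (n * (2 + 1) + 1)).filter
    (fun x => Nat.Coprime x n ∧ (n * (2 : ℕ) : ℚ) / (6 : ℕ) < (x : ℚ) ∧
      (x : ℚ) < (n * ((2 : ℕ) + 1) : ℚ) / (6 : ℕ))
  have hD : ∀ x, x ∈ D ↔ x.Coprime n ∧ n < 3 * x ∧ 2 * x < n := by
    intro x
    simp only [D, Finset.mem_filter, Finset.mem_range]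
    have h1 : ((n * (2 : ℕ) : ℚ) / (6 : ℕ) < (x : ℚ)) ↔ n < 3 * x := by
      rw [div_lt_iff₀ (by norm_num)]
      norm_cast
      omega
    have h2 : (x : ℚ) < (n * ((2 : ℕ) + 1) : ℚ) / (6 : ℕ) ↔ 2 * x < n := by
      rw [lt_div_iff₀ (by norm_num)]
      norm_cast
      omega
    rw [h1, h2]
    constructor
    · exact fun h ↦ h.2
    · exact fun h ↦ ⟨by omega, h⟩
  choose! h hirr hdeg using fun (p : ℕ) (hp : p ≠ 0) ↦ exists_irreducible_natDegree_eq F hp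
  let subspaceCond (k : ℕ) (g : G) : Prop := ∃ W : Submodule F (Fin n → F),
    Module.finrank F W = k ∧ W.map (Matrix.toLin' (g : GL (Fin n) F).val) ≤ W
  let fieldCond (p : ℕ) (g : G) : Prop := ∃ A : Matrix (Fin n) (Fin n) F,
    aeval A (h p) = 0 ∧ Commute (g : GL (Fin n) F).val A
  let P : (Finset.Icc 1 (n / 3) ⊕ D) ⊕ n.primeFactors → G → Prop :=
    Sum.elim (Sum.elim (fun k ↦ subspaceCond k) (fun k ↦ subspaceCond k)) (fun p ↦ fieldCond p)
  refine (gammaCover_le_card P ?_ ?_).trans_eq ?_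
  · rintro ((⟨k, hk⟩ | ⟨k, hk⟩) | ⟨p, hp⟩)
    · rw [Finset.mem_Icc] at hk
      exact exists_proper_subgroup_of_finrank (k := k) hG (by omega) (by omega)
    · rw [hD] at hk
      exact exists_proper_subgroup_of_finrank (k := k) hG (by omega) (by omega)
    · have hp := Nat.prime_of_mem_primeFactors hp
      exact exists_proper_subgroup_of_irreducible hG (hirr p hp.ne_zero)
        (by rw [hdeg p hp.ne_zero]; exact hp.ne_one) (by omega)
  · intro g
    set A : Matrix (Fin n) (Fin n) F := (g : GL (Fin n) F).val with hA
    have hχ : A.charpoly.natDegree = n := by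
      rw [Matrix.charpoly_natDegree_eq_dim, Fintype.card_fin]
    by_contra! hcon
    have hsub : ∀ f, Irreducible f → f ∣ A.charpoly → subspaceCond f.natDegree g := by
      intro f hf hfd
      refine exists_invariant_of_dvd_minpoly (Matrix.toLin' A) hf ?_
      rw [Matrix.minpoly_toLin']
      exact dvd_minpoly_of_dvd_charpoly A hf hfd
    obtain ⟨p, hp, hpn, hpd⟩ := exists_prime_dvd_natDegree_of_forall_not (by omega) hχ
      fun f hf hfd ↦ by
        have hpos := hf.natDegree_pos
        have h3 : n < 3 * f.natDegree := by
          by_contra! hle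
          exact hcon (.inl (.inl ⟨f.natDegree, Finset.mem_Icc.mpr ⟨hpos, by omega⟩⟩)) (hsub f hf hfd)
        refine ⟨h3, fun hc ↦ ?_⟩
        by_contra! hlt
        exact hcon (.inl (.inr ⟨f.natDegree, (hD _).mpr ⟨hc, h3, hlt⟩⟩)) (hsub f hf hfd)
    refine hcon (.inr ⟨p, Nat.mem_primeFactors.mpr ⟨hp, hpn, by omega⟩⟩) ?_
    exact exists_commute_aeval_eq_zero (hirr p hp.ne_zero)
      (by rwa [hdeg p hp.ne_zero]) A.charpoly_monic.ne_zero A.aeval_self_charpoly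
  · simp only [Fintype.card_sum, Fintype.card_coe, Nat.card_Icc, Nat.add_sub_cancel]
    rfl
end

section
/- Let G be a non-cyclic finite group. Then κ(G) ≤ γ(G). -/
theorem IsIndependentClasses.card_le {G : Type*} [Group G] {S : Finset (ConjClasses G)}
    (hS : IsIndependentClasses G S) {k : ℕ} (hk : IsNormalCover G k) : S.card ≤ k := by
  obtain ⟨H, hH, hcov⟩ := hk
  have hmeet : ∀ c : ConjClasses G, ∃ i : Fin k, ∃ y ∈ c.carrier, y ∈ H i := by
    intro c
    obtain ⟨g, rfl⟩ := ConjClasses.exists_rep c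
    obtain ⟨i, x, hx⟩ := hcov g
    exact ⟨i, x * g * x⁻¹, ConjClasses.mem_carrier_iff_mk_eq.2
      (ConjClasses.mk_eq_mk_iff_isConj.2 (isConj_iff.2 ⟨x, rfl⟩).symm), hx⟩
  choose f y hyc hyH using hmeet
  have hinj : Set.InjOn f S := by
    intro c hc d hd hcd
    by_contra hne
    refine hH (f c) (top_le_iff.1 ?_)
    rw [← hS c hc d hd hne _ (hyc c) _ (hyc d), Subgroup.closure_le, Set.pair_subset_iff]
    exact ⟨hyH c, by rw [hcd]; exact hyH d⟩
  simpa using Finset.card_le_card_of_injOn f (t := Finset.univ) (by simp) hinj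

theorem exists_isNormalCover_of_not_isCyclic (G : Type*) [Group G] [Finite G]
    (h : ¬ IsCyclic G) : ∃ k, IsNormalCover G k := by
  let e := Finite.equivFin G
  refine ⟨Nat.card G, fun i => Subgroup.zpowers (e.symm i), fun i hi => h ?_, fun g => ⟨e g, 1, ?_⟩⟩
  · exact isCyclic_iff_exists_zpowers_eq_top.2 ⟨_, hi⟩
  · simp

theorem kappa_le_gamma (G : Type*) [Group G] [Finite G] (h : ¬ IsCyclic G) :
    kappaIndep G ≤ gammaCover G := by
  have hcover : IsNormalCover G (gammaCover G) :=
    Nat.sInf_mem (exists_isNormalCover_of_not_isCyclic G h)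
  refine csSup_le ⟨0, ∅, by simp, by simp [IsIndependentClasses]⟩ ?_
  rintro _ ⟨S, rfl, hS⟩
  exact hS.card_le hcover
end

section
/- Let V be an n-dimensional vector space over the finite field F_q, let X be an invertible linear map of V, and let 0 ≤ k ≤ n. If X stabilizes a k-dimensional subspace of V, then X stabilizes a subspace of V of dimension n − k. -/
open Polynomial in
/-- A prime-power quotient of `F[X]` is a symmetric Frobenius algebra: some linear functional
makes the form `(a, b) ↦ l (a * b)` nondegenerate. -/
theorem exists_dual_forall_ne_zero_exists_mul_ne_zero {F : Type*} [Field F] {p : F[X]}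
    (hp : Irreducible p) (e : ℕ) :
    ∃ l : (F[X] ⧸ Ideal.span {p ^ e}) →ₗ[F] F, ∀ a, a ≠ 0 → ∃ b, l (a * b) ≠ 0 := by
  obtain _ | e := e
  · refine ⟨0, fun a ha => (ha ?_).elim⟩
    obtain ⟨a, rfl⟩ := Ideal.Quotient.mk_surjective a
    simp [Ideal.Quotient.eq_zero_iff_mem]
  have hs : Ideal.Quotient.mk (Ideal.span {p ^ (e + 1)}) (p ^ e) ≠ 0 := by
    rw [Ne, Ideal.Quotient.eq_zero_iff_mem, Ideal.mem_span_singleton,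
      pow_dvd_pow_iff hp.ne_zero hp.not_isUnit]
    omega
  obtain ⟨l, hl⟩ := Module.Projective.exists_dual_ne_zero F hs
  refine ⟨l, fun a ha => ?_⟩
  obtain ⟨a, rfl⟩ := Ideal.Quotient.mk_surjective a
  rw [Ne, Ideal.Quotient.eq_zero_iff_mem, Ideal.mem_span_singleton] at ha
  obtain ⟨g, hg⟩ := IsPrincipalIdealRing.principal (Ideal.span {a, p ^ (e + 1)})
  change _ = Ideal.span {g} at hg
  have hga : g ∣ a := by
    rw [← Ideal.mem_span_singleton, ← hg]
    exact Ideal.subset_span (by simp)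
  have hgp : g ∣ p ^ (e + 1) := by
    rw [← Ideal.mem_span_singleton, ← hg]
    exact Ideal.subset_span (by simp)
  obtain ⟨j, hj, hgj⟩ := (dvd_prime_pow hp.prime _).1 hgp
  have hje : j ≠ e + 1 := by
    rintro rfl
    exact ha (hgj.symm.dvd.trans hga)
  have hmem : p ^ e ∈ Ideal.span {a, p ^ (e + 1)} := by
    rw [hg, Ideal.mem_span_singleton]
    exact hgj.dvd.trans (pow_dvd_pow p (by omega))
  obtain ⟨b, c, hbc⟩ := Ideal.mem_span_pair.1 hmem
  refine ⟨Ideal.Quotient.mk _ b, ?_⟩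
  have : Ideal.Quotient.mk (Ideal.span {p ^ (e + 1)}) a * Ideal.Quotient.mk _ b =
      Ideal.Quotient.mk _ (p ^ e) := by
    rw [← map_mul, Ideal.Quotient.eq, Ideal.mem_span_singleton, ← hbc]
    exact ⟨-c, by ring⟩
  rwa [this]

open Polynomial in
/-- Every endomorphism of a finite-dimensional vector space is self-adjoint for some nondegenerate
bilinear form. -/
theorem exists_nondegenerate_isSelfAdjoint {F V : Type*} [Field F] [AddCommGroup V] [Module F V]
    [FiniteDimensional F V] (f : Module.End F V) :
    ∃ B : LinearMap.BilinForm F V, B.Nondegenerate ∧ ∀ v w, B (f v) w = B v (f w) := by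
  classical
  obtain ⟨ι, _, p, hp, e, ⟨E⟩⟩ := Module.equiv_directSum_of_isTorsion
    (Module.AEval.isTorsion_of_finiteDimensional F V f)
  choose l hl using fun i => exists_dual_forall_ne_zero_exists_mul_ne_zero (hp i) (e i)
  let g : ∀ i, V →ₗ[F] F[X] ⧸ Ideal.span {p i ^ e i} := fun i =>
    ((DirectSum.component F[X] ι (fun i => F[X] ⧸ Ideal.span {p i ^ e i}) i ∘ₗ
      E.toLinearMap).restrictScalars F) ∘ₗ (Module.AEval.of F V f).toLinearMap
  have hg : ∀ i v, g i v = E (Module.AEval.of F V f v) i := fun _ _ => rfl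
  have hgf : ∀ i v, g i (f v) = Ideal.Quotient.mk _ X * g i v := by
    intro i v
    have : Module.AEval.of F V f (f v) = (X : F[X]) • Module.AEval.of F V f v :=
      (Module.AEval.X_smul_of f v).symm
    rw [hg, hg, this, map_smul]
    rfl
  let B : LinearMap.BilinForm F V :=
    ∑ i, ((LinearMap.mul F (F[X] ⧸ Ideal.span {p i ^ e i})).compr₂ (l i)).compl₁₂ (g i) (g i)
  have hB : ∀ v w, B v w = ∑ i, l i (g i v * g i w) := fun v w => by simp [B]
  have hsymm : ∀ v w, B v w = B w v := fun v w => by simp only [hB, mul_comm]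
  have hsep : ∀ v, (∀ w, B v w = 0) → v = 0 := by
    intro v hv
    by_contra hne
    have : ∃ i, g i v ≠ 0 := by
      by_contra! h
      refine hne ((Module.AEval.of F V f).injective (E.injective ?_))
      rw [map_zero, map_zero]
      exact DFinsupp.ext h
    obtain ⟨i, hi⟩ := this
    obtain ⟨b, hb⟩ := hl i _ hi
    let w := (Module.AEval.of F V f).symm (E.symm (DirectSum.lof F[X] ι _ i b))
    have hw : ∀ j, g j w = DirectSum.lof F[X] ι (fun i => F[X] ⧸ Ideal.span {p i ^ e i}) i b j := by
      intro j
      simp [hg, w]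
    refine hb ?_
    rw [← hv w, hB, Finset.sum_eq_single i]
    · rw [hw, DirectSum.lof_apply]
    · intro j _ hj
      rw [hw, DirectSum.lof_eq_of, DirectSum.of_eq_of_ne _ _ _ hj, mul_zero, map_zero]
    · simp
  refine ⟨B, ⟨hsep, fun w hw => hsep w fun v => by rw [hsymm, hw]⟩, fun v w => ?_⟩
  simp only [hB, hgf, mul_left_comm, mul_assoc]

theorem stabilizes_complementary_dimension
    (q n k : ℕ) (hq : IsPrimePow q) (hk : k ≤ n)
    (F : Type*) [Field F] [Fintype F] (hF : Fintype.card F = q)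
    (V : Type*) [AddCommGroup V] [Module F V] [FiniteDimensional F V]
    (hV : Module.finrank F V = n)
    (X : V ≃ₗ[F] V)
    (U : Submodule F V) (hU : Module.finrank F U = k)
    (hXU : ∀ v ∈ U, X v ∈ U) :
    ∃ W : Submodule F V, Module.finrank F W = n - k ∧ ∀ v ∈ W, X v ∈ W := by
  obtain ⟨B, hB, hX⟩ := exists_nondegenerate_isSelfAdjoint (X : Module.End F V)
  refine ⟨B.orthogonal U, by rw [LinearMap.BilinForm.finrank_orthogonal hB, hV, hU], ?_⟩
  intro w hw u hu
  exact (hX u w).symm.trans (hw (X u) (hXU u hu))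
end

section
/- Let V be an n-dimensional vector space over the finite field F_q, let p be a prime dividing n, and let X be an invertible linear map of V. If X stabilizes no subspace of V whose dimension is nonzero, less than n, and coprime to p, then there exists an F_{q^p}-vector space structure on V whose scalar multiplication restricted to F_q agrees with the given F_q-structure, and with respect to which X is F_{q^p}-linear. -/
/-- An `F_{q^p}`-vector space structure on `V` (given by a field `K` with `m` elements)
extending the `F`-structure, with respect to which the map `X` is `K`-linear. -/
structure ExtScalarStructure (m : ℕ) (F : Type*) [Field F] (V : Type*) [AddCommGroup V]
    [Module F V] (X : V → V) where
  K : Type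
  [fieldK : Field K]
  [fintypeK : Fintype K]
  cardK : Fintype.card K = m
  [moduleK : Module K V]
  ι : F →+* K
  compat : ∀ (c : F) (v : V), ι c • v = c • v
  linearX : ∀ (c : K) (v : V), X (c • v) = c • X v

/-- A formally smooth `F`-algebra maps into a finite-dimensional commutative `F`-algebra as soon as it
maps into each residue field. -/
theorem nonempty_algHom_of_forall_quotient_maximal {F K A : Type*} [Field F] [CommRing K]
    [Algebra F K] [Algebra.FormallySmooth F K] [CommRing A] [Algebra F A] [FiniteDimensional F A]
    (h : ∀ M : Ideal A, M.IsMaximal → Nonempty (K →ₐ[F] A ⧸ M)) :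
    Nonempty (K →ₐ[F] A) := by
  have : IsArtinianRing A := .of_finite F A
  let f (M : MaximalSpectrum A) : K →ₐ[F] A ⧸ M.asIdeal := (h M.asIdeal M.isMaximal).some
  let g : K →ₐ[F] A ⧸ nilradical A :=
    ((IsArtinianRing.quotNilradicalEquivPi A).restrictScalars F).symm.toAlgHom.comp
      (AlgHom.pi f)
  exact ⟨Algebra.FormallySmooth.lift _ IsArtinianRing.isNilpotent_nilradical g⟩

/-- A finite faithful module over a finite-dimensional commutative algebra contains a submodule with
the dimension of any given residue field. -/
theorem exists_submodule_finrank_eq_finrank_quotient {F A V : Type*} [Field F] [CommRing A]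
    [Algebra F A] [FiniteDimensional F A] [AddCommGroup V] [Module F V] [Module A V]
    [IsScalarTower F A V] [Module.Finite A V] [FaithfulSMul A V] (M : Ideal A) [M.IsMaximal] :
    ∃ U : Submodule A V, Module.finrank F U = Module.finrank F (A ⧸ M) := by
  have : IsArtinianRing A := .of_finite F A
  have hM : M ∈ associatedPrimes A V := by
    apply Module.associatedPrimes.minimalPrimes_annihilator_subset_associatedPrimes
    rw [(Module.annihilator_eq_bot).2 inferInstance]
    exact IsArtinianRing.mem_minimalPrimes bot_le
  obtain ⟨-, x, hx⟩ := Submodule.isAssociatedPrime_iff.1 hM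
  have hMx : M = Ideal.torsionOf A V x := by
    ext a
    rw [hx, Submodule.mem_colon_singleton, Submodule.mem_bot, Ideal.mem_torsionOf_iff]
  subst hMx
  exact ⟨A ∙ x, ((Ideal.quotTorsionOfEquivSpanSingleton A V x).restrictScalars F).finrank_eq.symm⟩

open scoped IsMulCommutative in
/-- If `d` divides the dimension of every subspace stable under `T`, then every extension of the
finite field `F` of degree `d` acts on `V` by maps commuting with `T`. -/
theorem exists_algHom_end_commute_of_finrank_dvd {F K V : Type*} [Field F] [Finite F] [Field K]
    [Algebra F K] [FiniteDimensional F K] [AddCommGroup V] [Module F V] [FiniteDimensional F V]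
    (T : Module.End F V)
    (hT : ∀ U : Submodule F V, (∀ v ∈ U, T v ∈ U) → Module.finrank F K ∣ Module.finrank F U) :
    ∃ φ : K →ₐ[F] Module.End F V, ∀ c, Commute T (φ c) := by
  let A := Algebra.adjoin F {T}
  have hTA : T ∈ A := Algebra.self_mem_adjoin_singleton F T
  have : Module.Finite A V := .of_restrictScalars_finite F A V
  have : Algebra.FormallyEtale F K := .of_isSeparable F K
  obtain ⟨φ⟩ : Nonempty (K →ₐ[F] A) := by
    refine nonempty_algHom_of_forall_quotient_maximal fun M hM ↦ ?_
    obtain ⟨U, hU⟩ := exists_submodule_finrank_eq_finrank_quotient (F := F) (V := V) M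
    let := Ideal.Quotient.field M
    have : Finite (A ⧸ M) := Module.finite_of_finite F
    refine FiniteField.nonempty_algHom_of_finrank_dvd ?_
    rw [← hU]
    exact hT (U.restrictScalars F) fun v hv ↦ U.smul_mem (⟨T, hTA⟩ : A) hv
  refine ⟨A.val.comp φ, fun c ↦ ?_⟩
  exact congrArg Subtype.val (mul_comm (⟨T, hTA⟩ : A) (φ c))

theorem extension_field_structure_of_no_coprime_invariant_subspace
    (q n p : ℕ) (hq : IsPrimePow q) (hp : p.Prime) (hpn : p ∣ n)
    (F : Type*) [Field F] [Fintype F] (hF : Fintype.card F = q)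
    (V : Type*) [AddCommGroup V] [Module F V] [FiniteDimensional F V]
    (hV : Module.finrank F V = n)
    (X : V ≃ₗ[F] V)
    (hX : ¬ ∃ U : Submodule F V, (∀ v ∈ U, X v ∈ U) ∧
      Module.finrank F U ≠ 0 ∧ Module.finrank F U < n ∧
      Nat.Coprime (Module.finrank F U) p) :
    Nonempty (ExtScalarStructure (q ^ p) F V ⇑X) := by
  have hdvd (U : Submodule F V) (hU : ∀ v ∈ U, X v ∈ U) : p ∣ Module.finrank F U := by
    by_contra hp'
    refine hX ⟨U, hU, fun h0 ↦ hp' (h0 ▸ dvd_zero p), ?_,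
      ((Nat.Prime.coprime_iff_not_dvd hp).2 hp').symm⟩
    exact lt_of_le_of_ne (hV ▸ U.finrank_le) fun h ↦ hp' (h ▸ hpn)
  have : NeZero p := ⟨hp.ne_zero⟩
  obtain ⟨l, hl⟩ := CharP.exists F
  have : Fact l.Prime := ⟨CharP.char_is_prime F l⟩
  let K := FiniteField.Extension F l p
  obtain ⟨φ, hφ⟩ := exists_algHom_end_commute_of_finrank_dvd (K := K) (X : Module.End F V)
    fun U hU ↦ (FiniteField.finrank_extension F l p).symm ▸ hdvd U hU
  let : Fintype K := Fintype.ofFinite K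
  let : Module K V := Module.compHom V φ.toRingHom
  refine ⟨{
    K := K
    cardK := ?_
    ι := algebraMap F K
    compat := fun c v ↦ ?_
    linearX := fun c v ↦ ?_ }⟩
  · rw [Fintype.card_eq_nat_card, FiniteField.natCard_extension, Nat.card_eq_fintype_card, hF]
  · change φ (algebraMap F K c) v = c • v
    rw [φ.commutes, Module.algebraMap_end_apply]
  · exact LinearMap.congr_fun (hφ c).eq v
end

section
/- Let n ≥ 2, let p be a prime dividing n, let q be a prime power, and let G be a group with SL_n(q) ≤ G ≤ GL_n(q). Then γ(G) ≤ ⌊(1 − 1/p)·n/2⌋ + 1 + ε, where ε = 1 if p = 2 and n/2 is odd, and ε = 0 otherwise. -/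
open Polynomial Module

theorem nonempty_algHom_of_finrank_dvd_quotients {F E R : Type*} [Field F] [Finite F]
    [Field E] [Algebra F E] [FiniteDimensional F E] [CommRing R] [Algebra F R] [Finite R]
    (h : ∀ I : Ideal R, I.IsMaximal → finrank F E ∣ finrank F (R ⧸ I)) :
    Nonempty (E →ₐ[F] R) := by
  have : Finite E := Module.finite_of_finite F
  obtain ⟨θ, hθ⟩ := Field.exists_primitive_element F E
  have hint : IsIntegral F θ := Algebra.IsIntegral.isIntegral θ
  have hroot (I : MaximalSpectrum R) :
      ∃ y : R ⧸ I.asIdeal, aeval y (minpoly F θ) = 0 := by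
    let := Ideal.Quotient.field I.asIdeal
    have : Finite (R ⧸ I.asIdeal) := Finite.of_surjective _ Ideal.Quotient.mk_surjective
    obtain ⟨ψ⟩ := FiniteField.nonempty_algHom_of_finrank_dvd (h I.asIdeal I.isMaximal)
    exact ⟨ψ θ, by rw [aeval_algHom_apply, minpoly.aeval, map_zero]⟩
  choose y hy using hroot
  obtain ⟨z, hz⟩ := (IsArtinianRing.quotNilradicalEquivPi R).surjective y
  obtain ⟨x, rfl⟩ := Ideal.Quotient.mk_surjective z
  have hmk (I : MaximalSpectrum R) : Ideal.Quotient.mkₐ F I.asIdeal x = y I := by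
    rw [← hz]; rfl
  have hnil : IsNilpotent (aeval x (minpoly F θ)) := by
    rw [← mem_nilradical, IsArtinianRing.nilradical_eq_iInf, Ideal.mem_iInf]
    intro I
    rw [← Ideal.Quotient.eq_zero_iff_mem, ← Ideal.Quotient.mkₐ_eq_mk F, ← aeval_algHom_apply,
      hmk, hy]
  have hunit : IsUnit (aeval x (derivative (minpoly F θ))) := by
    obtain ⟨a, b, hab⟩ := Algebra.IsSeparable.isSeparable F θ
    have := congrArg (aeval x) hab
    simp only [map_add, map_mul, map_one] at this
    refine isUnit_of_mul_isUnit_right (x := aeval x b) ?_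
    rw [eq_sub_of_add_eq' this]
    exact ((Commute.all _ _).isNilpotent_mul_left hnil).isUnit_one_sub
  obtain ⟨r, ⟨-, hr⟩, -⟩ := existsUnique_nilpotent_sub_and_aeval_eq_zero hnil hunit
  let e : E ≃ₐ[F] AdjoinRoot (minpoly F θ) :=
    (IntermediateField.topEquiv.symm.trans (IntermediateField.equivOfEq hθ.symm)).trans
      (IntermediateField.adjoinRootEquivAdjoin F hint).symm
  exact ⟨(AdjoinRoot.liftAlgHom _ (Algebra.ofId F R) r hr).comp e.toAlgHom⟩

theorem nonempty_algHom_of_finrank_dvd_irreducible_factors {F E A : Type*} [Field F] [Finite F]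
    [Field E] [Algebra F E] [FiniteDimensional F E] [Ring A] [Algebra F A] (a : A) (P : F[X])
    (hP : P ≠ 0) (ha : aeval a P = 0)
    (h : ∀ f : F[X], Irreducible f → f ∣ P → finrank F E ∣ f.natDegree) :
    ∃ φ : E →ₐ[F] A, ∀ x, Commute a (φ x) := by
  let J := Ideal.span {P}
  let κ : (F[X] ⧸ J) →ₐ[F] A := Ideal.Quotient.liftₐ J (aeval a) fun b hb => by
    obtain ⟨c, rfl⟩ := Ideal.mem_span_singleton'.1 hb
    rw [map_mul, ha, mul_zero]
  have : FiniteDimensional F (F[X] ⧸ J) := (AdjoinRoot.powerBasis hP).finite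
  have : Finite (F[X] ⧸ J) := Module.finite_of_finite F
  suffices Nonempty (E →ₐ[F] F[X] ⧸ J) by
    obtain ⟨ψ⟩ := this
    refine ⟨κ.comp ψ, fun x => ?_⟩
    have : a = κ (Ideal.Quotient.mk J X) := ((Ideal.Quotient.liftₐ_apply ..).trans (aeval_X a)).symm
    rw [this]
    exact (Commute.all _ (ψ x)).map κ
  refine nonempty_algHom_of_finrank_dvd_quotients fun I hI => ?_
  let π : F[X] →ₐ[F] (F[X] ⧸ J) ⧸ I := (Ideal.Quotient.mkₐ F I).comp (Ideal.Quotient.mkₐ F J)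
  have hπ : Function.Surjective π :=
    (Ideal.Quotient.mkₐ_surjective F I).comp (Ideal.Quotient.mkₐ_surjective F J)
  let := Ideal.Quotient.field I
  have hmax : (RingHom.ker π).IsMaximal := RingHom.ker_isMaximal_of_surjective _ hπ
  obtain ⟨f, hf⟩ := IsPrincipalIdealRing.principal (RingHom.ker π)
  rw [Ideal.submodule_span_eq] at hf
  have hPf : f ∣ P := by
    rw [← Ideal.mem_span_singleton, ← hf, RingHom.mem_ker]
    simp [π, J, Ideal.Quotient.eq_zero_iff_mem.2 (Ideal.mem_span_singleton_self P)]
  have hf0 : f ≠ 0 := fun h0 => hP (zero_dvd_iff.1 (h0 ▸ hPf))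
  have hirr : Irreducible f := by
    rw [hf] at hmax
    exact ((Ideal.span_singleton_prime hf0).1 hmax.isPrime).irreducible
  have e := (Ideal.quotientEquivAlgOfEq F hf).symm.trans
    (Ideal.quotientKerAlgEquivOfSurjective hπ)
  rw [← e.toLinearEquiv.finrank_eq, finrank_quotient_span_eq_natDegree]
  exact h f hirr hPf

theorem exists_irreducible_dvd_not_dvd_natDegree {F : Type*} [Field F] (p : ℕ) (f : F[X])
    (hf : ¬ p ∣ f.natDegree) : ∃ g, Irreducible g ∧ g ∣ f ∧ ¬ p ∣ g.natDegree := by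
  induction f using WfDvdMonoid.induction_on_irreducible with
  | zero => simp at hf
  | unit u hu => simp [natDegree_eq_zero_of_isUnit hu] at hf
  | mul a i ha hi ih =>
    by_cases hpi : p ∣ i.natDegree
    · rw [natDegree_mul hi.ne_zero ha, Nat.dvd_add_right hpi] at hf
      obtain ⟨g, hg, hga, hgp⟩ := ih hf
      exact ⟨g, hg, hga.mul_left i, hgp⟩
    · exact ⟨i, hi, dvd_mul_right i a, hpi⟩

theorem exists_irreducible_dvd_not_dvd_natDegree_le_half {F : Type*} [Field F] (p : ℕ) (P : F[X])
    (hp : p ∣ P.natDegree) (hP : P ≠ 0) (f : F[X]) (hf : Irreducible f) (hfP : f ∣ P)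
    (hpf : ¬ p ∣ f.natDegree) :
    ∃ g, Irreducible g ∧ g ∣ P ∧ ¬ p ∣ g.natDegree ∧ g.natDegree ≤ P.natDegree / 2 := by
  by_cases hle : f.natDegree ≤ P.natDegree / 2
  · exact ⟨f, hf, hfP, hpf, hle⟩
  obtain ⟨h, rfl⟩ := hfP
  have hh : h ≠ 0 := right_ne_zero_of_mul hP
  have hdeg := natDegree_mul hf.ne_zero hh
  obtain ⟨g, hg, hgh, hgp⟩ := exists_irreducible_dvd_not_dvd_natDegree p h
    fun hph => hpf ((Nat.dvd_add_left hph).1 (hdeg ▸ hp))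
  have := natDegree_le_of_dvd hgh hh
  exact ⟨g, hg, hgh.mul_left f, hgp, by omega⟩

theorem exists_submodule_finrank_eq_of_dvd_charpoly {F V : Type*} [Field F] [AddCommGroup V]
    [Module F V] [FiniteDimensional F V] (T : End F V) (f : F[X]) (hf : Irreducible f)
    (hfT : f ∣ T.charpoly) :
    ∃ U : Submodule F V, finrank F U = f.natDegree ∧ ∀ v ∈ U, T v ∈ U := by
  obtain ⟨v, hv, hv0⟩ : ∃ v, aeval T f v = 0 ∧ v ≠ 0 := by
    by_contra! hinj
    have hunit : IsUnit (aeval T f) := by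
      rw [LinearMap.isUnit_iff_ker_eq_bot, LinearMap.ker_eq_bot']
      exact hinj
    have : Fact (Irreducible f) := ⟨hf⟩
    let T' := T.baseChange (AdjoinRoot f)
    have hroot : T'.charpoly.IsRoot (AdjoinRoot.root f) := by
      rw [LinearMap.charpoly_baseChange, IsRoot, eval_map_algebraMap]
      exact eval₂_eq_zero_of_dvd_of_eval₂_eq_zero _ _ hfT (AdjoinRoot.eval₂_root f)
    obtain ⟨w, hw⟩ := ((End.hasEigenvalue_iff_isRoot_charpoly _ _).2 hroot).exists_hasEigenvector
    have hunit' : IsUnit (aeval T' f) := by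
      have := hunit.map (End.baseChangeHom F (AdjoinRoot f) V)
      rwa [← aeval_algHom_apply] at this
    have hfw : aeval T' f w = 0 := by
      rw [← aeval_map_algebraMap (AdjoinRoot f), End.aeval_apply_of_hasEigenvector hw,
        eval_map_algebraMap]
      exact (congrArg (· • w) (AdjoinRoot.eval₂_root f)).trans (zero_smul _ w)
    rw [LinearMap.isUnit_iff_ker_eq_bot, LinearMap.ker_eq_bot'] at hunit'
    exact hw.2 (hunit' w hfw)
  let ℓ : F[X] →ₗ[F] V := (LinearMap.applyₗ v).comp (aeval T).toLinearMap
  have hℓ (q : F[X]) : ℓ q = aeval T q v := rfl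
  have hker : LinearMap.ker ℓ = (Ideal.span {f}).restrictScalars F := by
    ext q
    rw [LinearMap.mem_ker, Submodule.restrictScalars_mem, Ideal.mem_span_singleton, hℓ]
    constructor
    · intro hq
      by_contra hfq
      obtain ⟨a, b, hab⟩ := (hf.coprime_iff_not_dvd.2 hfq)
      apply hv0
      have := congrArg (fun r => aeval T r v) hab
      simpa [hv, hq] using this.symm
    · rintro ⟨c, rfl⟩
      rw [mul_comm, map_mul, Module.End.mul_apply, hv, map_zero]
  refine ⟨LinearMap.range ℓ, ?_, ?_⟩
  · rw [← ℓ.quotKerEquivRange.finrank_eq, hker, ← finrank_quotient_span_eq_natDegree (f := f)]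
    rfl
  · rintro _ ⟨q, rfl⟩
    exact ⟨X * q, by simp [hℓ]⟩
theorem exists_linearEquiv_det_eq {K V : Type*} [Field K] [AddCommGroup V] [Module K V]
    [FiniteDimensional K V] [Nontrivial V] (c : K) (hc : c ≠ 0) :
    ∃ e : V ≃ₗ[K] V, LinearMap.det (e : V →ₗ[K] V) = c := by
  classical
  let b := finBasis K V
  have : Nonempty (Fin (finrank K V)) := b.index_nonempty
  obtain ⟨A, hA⟩ := Matrix.GeneralLinearGroup.det_surjective (n := Fin (finrank K V))
    (Units.mk0 c hc)
  have hA' : LinearMap.det (Matrix.toLin b b A) = c := by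
    rw [LinearMap.det_toLin, ← Matrix.GeneralLinearGroup.val_det_apply, hA, Units.val_mk0]
  exact ⟨LinearMap.equivOfDetNeZero (Matrix.toLin b b A) (hA' ▸ hc), hA'⟩

theorem exists_linearEquiv_map_mem_iff_det_eq_one {K V : Type*} [Field K] [AddCommGroup V]
    [Module K V] [FiniteDimensional K V] (U W : Submodule K V) (h : finrank K U = finrank K W)
    (hW : W ≠ ⊥) :
    ∃ e : V ≃ₗ[K] V, LinearMap.det (e : V →ₗ[K] V) = 1 ∧ ∀ v, e v ∈ W ↔ v ∈ U := by
  obtain ⟨e, he⟩ := Submodule.exists_linearEquiv_restrict_eq (LinearEquiv.ofFinrankEq U W h)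
  have heU : U.map (e : V →ₗ[K] V) = W := by
    refine Submodule.eq_of_le_of_finrank_eq ?_ ?_
    · rintro _ ⟨u, hu, rfl⟩
      exact (he ⟨u, hu⟩) ▸ Submodule.coe_mem _
    · rw [← h]
      exact LinearEquiv.finrank_map_eq e U
  obtain ⟨Q, hQ⟩ := Submodule.exists_isCompl W
  have : Nontrivial W := Submodule.nontrivial_iff_ne_bot.2 hW
  obtain ⟨d, hd⟩ := exists_linearEquiv_det_eq (V := W) (LinearMap.det (e : V →ₗ[K] V))⁻¹
    (inv_ne_zero e.isUnit_det'.ne_zero)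
  let s := W.prodEquivOfIsCompl Q hQ
  let d' : V ≃ₗ[K] V := s.symm ≪≫ₗ (d.prodCongr (LinearEquiv.refl K Q)) ≪≫ₗ s
  have hd' : LinearMap.det (d' : V →ₗ[K] V) = (LinearMap.det (e : V →ₗ[K] V))⁻¹ := by
    refine (LinearMap.det_conj (LinearMap.prodMap (d : W →ₗ[K] W) LinearMap.id) s).trans ?_
    rw [LinearMap.det_prodMap, hd, LinearMap.det_id, mul_one]
  have hmem (v : V) : d' v ∈ W ↔ v ∈ W := by
    obtain ⟨⟨w, q⟩, rfl⟩ := s.surjective v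
    have hs (w : W) (q : Q) : s (w, q) ∈ W ↔ q = 0 := by
      rw [Submodule.coe_prodEquivOfIsCompl', Submodule.add_mem_iff_right _ w.2]
      constructor
      · intro hq
        exact Subtype.ext (Submodule.disjoint_def.1 hQ.disjoint _ hq q.2)
      · rintro rfl
        exact W.zero_mem
    simp only [d', LinearEquiv.trans_apply, LinearEquiv.symm_apply_apply,
      LinearEquiv.prodCongr_apply, LinearEquiv.refl_apply, hs]
  refine ⟨e ≪≫ₗ d', ?_, fun v => ?_⟩
  · rw [LinearEquiv.coe_trans, LinearMap.det_comp, hd', inv_mul_cancel₀ e.isUnit_det'.ne_zero]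
  · rw [LinearEquiv.trans_apply, hmem, ← heU]
    exact e.toEquiv.injective.mem_set_image (s := (U : Set V))

theorem exists_linearEquiv_map_smul_det_eq_one {F E V W : Type*} [Field F] [Field E]
    [Finite E] [Algebra F E] [AddCommGroup V] [Module F V] [Module E V] [IsScalarTower F E V]
    [FiniteDimensional F V] [Nontrivial V]
    [AddCommGroup W] [Module F W] [Module E W] [IsScalarTower F E W] (ι : V ≃ₗ[F] W) :
    ∃ e : V ≃ₗ[F] W, LinearMap.det (e ≪≫ₗ ι.symm : V →ₗ[F] V) = 1 ∧
      ∀ (a : E) (v : V), e (a • v) = a • e v := by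
  have : FiniteDimensional E V := FiniteDimensional.right F E V
  have : FiniteDimensional F W := ι.finiteDimensional
  have : FiniteDimensional E W := FiniteDimensional.right F E W
  have : FiniteDimensional F E := Module.Finite.of_finite
  have hfin : finrank E V = finrank E W := by
    refine Nat.eq_of_mul_eq_mul_left (finrank_pos (R := F) (M := E)) ?_
    rw [finrank_mul_finrank, finrank_mul_finrank, ι.finrank_eq]
  let e₀ : V ≃ₗ[E] W := LinearEquiv.ofFinrankEq V W hfin
  let t : V ≃ₗ[F] V := (e₀.restrictScalars F) ≪≫ₗ ι.symm
  obtain ⟨u, hu⟩ := FiniteField.norm_surjective F E (LinearMap.det (t : V →ₗ[F] V))⁻¹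
  have hu0 : u ≠ 0 := by
    rintro rfl
    rw [Algebra.norm_zero, eq_comm, inv_eq_zero] at hu
    exact t.isUnit_det'.ne_zero hu
  obtain ⟨d, hd⟩ := exists_linearEquiv_det_eq (V := V) u hu0
  refine ⟨(d ≪≫ₗ e₀).restrictScalars F, ?_, fun a v => map_smul (d ≪≫ₗ e₀) a v⟩
  have : (((d ≪≫ₗ e₀).restrictScalars F ≪≫ₗ ι.symm : V ≃ₗ[F] V) : V →ₗ[F] V) =
    (t : V →ₗ[F] V) ∘ₗ ((d : V →ₗ[E] V).restrictScalars F) := rfl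
  rw [this, LinearMap.det_comp, LinearMap.det_restrictScalars, hd, hu,
    mul_inv_cancel₀ t.isUnit_det'.ne_zero]

theorem exists_linearEquiv_intertwine_det_eq_one {F E V : Type*} [Field F] [Field E]
    [Finite E] [Algebra F E] [AddCommGroup V] [Module F V] [FiniteDimensional F V] [Nontrivial V]
    (φ ψ : E →ₐ[F] End F V) :
    ∃ e : V ≃ₗ[F] V, LinearMap.det (e : V →ₗ[F] V) = 1 ∧ ∀ a v, e (φ a v) = ψ a (e v) := by
  have tower (χ : E →ₐ[F] End F V) : let := Module.compHom V χ.toRingHom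
      IsScalarTower F E V := by
    let := Module.compHom V χ.toRingHom
    refine ⟨fun r a v => ?_⟩
    change χ (r • a) v = r • χ a v
    rw [map_smul, LinearMap.smul_apply]
  exact @exists_linearEquiv_map_smul_det_eq_one F E V V _ _ _ _ _ _
    (Module.compHom V φ.toRingHom) (tower φ) _ _ _ _ (Module.compHom V ψ.toRingHom) (tower ψ)
    (LinearEquiv.refl F V)

theorem exists_mem_SLinGL {n : ℕ} {F : Type*} [Field F] (e : (Fin n → F) ≃ₗ[F] (Fin n → F))
    (he : LinearMap.det (e : (Fin n → F) →ₗ[F] (Fin n → F)) = 1) :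
    ∃ x ∈ SLinGL n F, Matrix.toLin' (x : Matrix (Fin n) (Fin n) F) = e := by
  refine ⟨_, ⟨⟨LinearMap.toMatrix' e, ?_⟩, rfl⟩, ?_⟩
  · rw [LinearMap.det_toMatrix', he]
  · exact Matrix.toLin'_toMatrix' _

theorem forall_mulVec_mem_iff {n : ℕ} {F : Type*} [Field F] (g : GL (Fin n) F)
    (U : Submodule F (Fin n → F)) (h : ∀ v ∈ U, (g : Matrix _ _ F).mulVec v ∈ U) (v : Fin n → F) :
    (g : Matrix _ _ F).mulVec v ∈ U ↔ v ∈ U := by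
  refine ⟨fun hv => ?_, h v⟩
  have hinj : Function.Injective (g : Matrix (Fin n) (Fin n) F).mulVecLin :=
    Matrix.mulVec_injective_of_isUnit g.isUnit
  have hmap : U.map (g : Matrix (Fin n) (Fin n) F).mulVecLin = U := by
    refine Submodule.eq_of_le_of_finrank_eq (Submodule.map_le_iff_le_comap.2 h) ?_
    exact (Submodule.equivMapOfInjective _ hinj U).finrank_eq.symm
  rw [← hmap] at hv
  obtain ⟨u, hu, huv⟩ := hv
  exact hinj huv ▸ hu

/-- The stabilizer in `G` of a subspace. -/
def subspaceStabilizer {n : ℕ} {F : Type*} [Field F] (G : Subgroup (GL (Fin n) F))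
    (W : Submodule F (Fin n → F)) : Subgroup G where
  carrier := {g | ∀ v, (g.1 : Matrix (Fin n) (Fin n) F).mulVec v ∈ W ↔ v ∈ W}
  one_mem' v := by simp
  mul_mem' {g h} hg hh v := by
    simp only [Subgroup.coe_mul, Units.val_mul, ← Matrix.mulVec_mulVec]
    rw [hg, hh]
  inv_mem' {g} hg v := by
    rw [← hg, Matrix.mulVec_mulVec, ← Units.val_mul, Subgroup.coe_inv, mul_inv_cancel,
      Units.val_one, Matrix.one_mulVec]

/-- The elements of `G` that commute with an algebra of matrices. -/
def algHomCentralizer {n : ℕ} {F E : Type*} [Field F] [Field E] [Algebra F E]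
    (G : Subgroup (GL (Fin n) F)) (φ : E →ₐ[F] Matrix (Fin n) (Fin n) F) : Subgroup G where
  carrier := {g | ∀ a, Commute (g.1 : Matrix (Fin n) (Fin n) F) (φ a)}
  one_mem' _ := Commute.one_left _
  mul_mem' hg hh a := (hg a).mul_left (hh a)
  inv_mem' hg a := (hg a).units_inv_left

theorem transvection_mem_SLinGL {n : ℕ} {F : Type*} [Field F] {i j : Fin n} (hij : i ≠ j) :
    ∃ x ∈ SLinGL n F, (x : Matrix (Fin n) (Fin n) F) = Matrix.transvection i j 1 :=
  ⟨_, ⟨Matrix.SpecialLinearGroup.transvection hij 1, rfl⟩, rfl⟩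

theorem subspaceStabilizer_ne_top {n : ℕ} {F : Type*} [Field F] (G : Subgroup (GL (Fin n) F))
    (hG : SLinGL n F ≤ G) (W : Submodule F (Fin n → F)) (i j : Fin n)
    (hi : Pi.single i 1 ∉ W) (hj : Pi.single j 1 ∈ W) : subspaceStabilizer G W ≠ ⊤ := by
  intro htop
  have hij : i ≠ j := by
    rintro rfl
    exact hi hj
  obtain ⟨x, hx, hxt⟩ := transvection_mem_SLinGL (F := F) hij
  have hmem : (⟨x, hG hx⟩ : G) ∈ subspaceStabilizer G W := htop ▸ Subgroup.mem_top _
  have := (hmem (Pi.single j 1)).2 hj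
  rw [hxt, Matrix.transvection, Matrix.add_mulVec, Matrix.one_mulVec,
    Submodule.add_mem_iff_right _ hj] at this
  apply hi
  convert this using 1
  ext k
  simp [Matrix.single_apply, Pi.single_apply, eq_comm]

theorem algHomCentralizer_ne_top {n : ℕ} {F E : Type*} [Field F] [Field E] [Algebra F E]
    (hn : n ≠ 0) (G : Subgroup (GL (Fin n) F)) (hG : SLinGL n F ≤ G)
    (φ : E →ₐ[F] Matrix (Fin n) (Fin n) F) (hE : finrank F E ≠ 1) :
    algHomCentralizer G φ ≠ ⊤ := by
  intro htop
  have : NeZero n := ⟨hn⟩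
  apply hE
  refine Subalgebra.bot_eq_top_iff_finrank_eq_one.1 (Algebra.eq_top_iff.2 ?_)
  intro a
  have hscalar : φ a ∈ Set.range (Matrix.scalar (Fin n)) := by
    refine Matrix.mem_range_scalar_of_commute_single fun i j hij => ?_
    obtain ⟨x, hx, hxt⟩ := transvection_mem_SLinGL (F := F) hij
    have hmem : (⟨x, hG hx⟩ : G) ∈ algHomCentralizer G φ := htop ▸ Subgroup.mem_top _
    have := hmem a
    rw [hxt, Matrix.transvection] at this
    simpa using this.sub_left (Commute.one_left _)
  obtain ⟨r, hr⟩ := hscalar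
  refine Algebra.mem_bot.2 ⟨r, φ.toRingHom.injective ?_⟩
  exact (φ.commutes r).trans hr

theorem exists_conj_mem_subspaceStabilizer {n : ℕ} {F : Type*} [Field F]
    (G : Subgroup (GL (Fin n) F)) (hG : SLinGL n F ≤ G) (U W : Submodule F (Fin n → F))
    (h : finrank F U = finrank F W) (hW : W ≠ ⊥) (g : G)
    (hg : ∀ v ∈ U, (g.1 : Matrix (Fin n) (Fin n) F).mulVec v ∈ U) :
    ∃ x : G, x * g * x⁻¹ ∈ subspaceStabilizer G W := by
  obtain ⟨e, hdet, he⟩ := exists_linearEquiv_map_mem_iff_det_eq_one U W h hW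
  obtain ⟨x, hx, hxe⟩ := exists_mem_SLinGL e hdet
  have hx' (v : Fin n → F) : (x : Matrix (Fin n) (Fin n) F).mulVec v ∈ W ↔ v ∈ U := by
    rw [← he, ← Matrix.toLin'_apply, hxe, LinearEquiv.coe_coe]
  refine ⟨⟨x, hG hx⟩, fun v => ?_⟩
  simp only [Subgroup.coe_mul, Units.val_mul, ← Matrix.mulVec_mulVec]
  rw [hx', forall_mulVec_mem_iff g.1 U hg, ← hx', Matrix.mulVec_mulVec, ← Units.val_mul,
    Subgroup.coe_inv, mul_inv_cancel, Units.val_one, Matrix.one_mulVec]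

theorem exists_conj_mem_algHomCentralizer {n : ℕ} {F E : Type*} [Field F] [Field E] [Finite E]
    [Algebra F E] (hn : n ≠ 0) (G : Subgroup (GL (Fin n) F)) (hG : SLinGL n F ≤ G)
    (φ ψ : E →ₐ[F] Matrix (Fin n) (Fin n) F) (g : G)
    (hg : ∀ a, Commute (g.1 : Matrix (Fin n) (Fin n) F) (φ a)) :
    ∃ x : G, x * g * x⁻¹ ∈ algHomCentralizer G ψ := by
  have : NeZero n := ⟨hn⟩
  let τ : Matrix (Fin n) (Fin n) F →ₐ[F] End F (Fin n → F) := Matrix.toLinAlgEquiv'.toAlgHom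
  obtain ⟨e, hdet, he⟩ := exists_linearEquiv_intertwine_det_eq_one (τ.comp φ) (τ.comp ψ)
  obtain ⟨x, hx, hxe⟩ := exists_mem_SLinGL e hdet
  have hx' (a : E) : (x : Matrix (Fin n) (Fin n) F) * φ a = ψ a * x := by
    refine Matrix.toLin'.injective (LinearMap.ext fun v => ?_)
    rw [Matrix.toLin'_mul_apply, Matrix.toLin'_mul_apply, hxe]
    exact he a v
  refine ⟨⟨x, hG hx⟩, fun a => ?_⟩
  have hψ : ψ a = (x : Matrix (Fin n) (Fin n) F) * φ a * (x⁻¹ : GL (Fin n) F) := by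
    rw [hx', mul_assoc, ← Units.val_mul, mul_inv_cancel, Units.val_one, mul_one]
  rw [hψ]
  change (x : Matrix (Fin n) (Fin n) F) * g.1 * (x⁻¹ : GL (Fin n) F) * _ =
    _ * ((x : Matrix (Fin n) (Fin n) F) * g.1 * (x⁻¹ : GL (Fin n) F))
  simp only [mul_assoc, Units.inv_mul_cancel_left, (hg a).left_comm]

theorem exists_submodule_finrank_eq_s14 (n k : ℕ) (F : Type*) [Field F] (hk : k ≤ n) :
    ∃ W : Submodule F (Fin n → F), finrank F W = k ∧
      ∀ i : Fin n, Pi.single i (1 : F) ∈ W ↔ i.1 < k := by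
  let b := Pi.basisFun F (Fin n)
  refine ⟨Submodule.span F (Set.range (b ∘ Fin.castLE hk)), ?_, fun i => ?_⟩
  · rw [finrank_span_eq_card (b.linearIndependent.comp _ (Fin.castLE_injective hk)),
      Fintype.card_fin]
  · rw [← Pi.basisFun_apply, Set.range_comp, b.mem_span_image, b.repr_self,
      Finsupp.support_single _ one_ne_zero, Finset.coe_singleton,
      Set.singleton_subset_iff, Fin.range_castLE, Set.mem_ofPred_eq]

theorem exists_algHom_matrix {n : ℕ} {F E : Type*} [Field F] [Field E] [Algebra F E]
    [FiniteDimensional F E] (h : finrank F E ∣ n) :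
    Nonempty (E →ₐ[F] Matrix (Fin n) (Fin n) F) := by
  obtain ⟨m, rfl⟩ := h
  let b : Basis (Fin (finrank F E * m)) F (Fin m → E) :=
    finBasisOfFinrankEq F _ (by rw [finrank_pi_fintype]; simp [mul_comm])
  exact ⟨(LinearMap.toMatrixAlgEquiv b).toAlgHom.comp (Algebra.lsmul F F (Fin m → E))⟩

theorem IsNormalCover.of_fintype {G : Type*} [Group G] {ι : Type*} [Fintype ι]
    (H : ι → Subgroup G) (hH : ∀ i, H i ≠ ⊤) (hcov : ∀ g : G, ∃ i, ∃ x : G, x * g * x⁻¹ ∈ H i) :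
    IsNormalCover G (Fintype.card ι) := by
  let e := Fintype.equivFin ι
  refine ⟨fun i => H (e.symm i), fun i => hH _, fun g => ?_⟩
  obtain ⟨i, x, hx⟩ := hcov g
  exact ⟨e i, x, by rwa [← e.symm_apply_apply i] at hx⟩

theorem card_filter_not_dvd (N p : ℕ) :
    ((Finset.Icc 1 N).filter fun k => ¬ p ∣ k).card = N - N / p := by
  have h := Finset.card_filter_add_card_filter_not (s := Finset.Icc 1 N) (fun k => p ∣ k)
  have h' : ((Finset.Icc 1 N).filter fun k => p ∣ k).card = N / p := by
    rw [← Nat.card_multiples' N p]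
    congr 1
    ext k
    simp only [Finset.mem_filter, Finset.mem_Icc, Finset.mem_range]
    omega
  rw [Nat.card_Icc] at h
  omega

theorem half_sub_half_div_le (n p : ℕ) (hp : p.Prime) (hpn : p ∣ n) :
    ((n / 2 - n / 2 / p : ℕ) : ℤ) ≤
      ⌊((1 - 1 / (p : ℚ)) * n / 2 : ℚ)⌋ + (if p = 2 ∧ Odd (n / 2) then 1 else 0) := by
  obtain ⟨m, rfl⟩ := hpn
  have hp0 : (p : ℚ) ≠ 0 := Nat.cast_ne_zero.2 hp.ne_zero
  have hfl : ((1 - 1 / (p : ℚ)) * (p * m : ℕ) / 2 : ℚ) = ((p : ℚ) - 1) * m / 2 := by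
    push_cast
    field_simp
  rw [hfl, Nat.div_div_eq_div_mul, mul_comm 2 p, Nat.mul_div_mul_left _ _ hp.pos]
  rcases hp.eq_two_or_odd' with rfl | ⟨r, rfl⟩
  · have : ⌊(((2 : ℕ) : ℚ) - 1) * m / 2⌋ = (m / 2 : ℕ) := by
      rw [Int.floor_eq_iff]
      have h1 := Nat.div_add_mod m 2
      have h2 := Nat.mod_lt m two_pos
      have h1' : (2 : ℚ) * (m / 2 : ℕ) + (m % 2 : ℕ) = m := mod_cast h1
      have h2' : ((m % 2 : ℕ) : ℚ) < 2 := mod_cast h2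
      have h3' : (0 : ℚ) ≤ ((m % 2 : ℕ) : ℚ) := Nat.cast_nonneg _
      rw [Int.cast_natCast]
      push_cast
      constructor <;> linarith
    rw [this, Nat.mul_div_cancel_left _ two_pos]
    split_ifs with h
    · omega
    · have : ¬ Odd m := fun hm => h ⟨rfl, hm⟩
      rw [Nat.not_odd_iff_even, Nat.even_iff] at this
      omega
  · have : ⌊(((2 * r + 1 : ℕ) : ℚ) - 1) * m / 2⌋ = (r * m : ℕ) := by
      rw [Int.floor_eq_iff]
      push_cast
      constructor <;> linarith
    rw [this]
    have hlin : (2 * r + 1) * m = 2 * (r * m) + m := by ring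
    rw [hlin]
    split_ifs <;> omega

theorem gamma_le_single_prime_bound
    (n q p : ℕ) (hn : 2 ≤ n) (hp : p.Prime) (hpn : p ∣ n) (hq : IsPrimePow q)
    (F : Type*) [Field F] [Fintype F] (hF : Fintype.card F = q)
    (G : Subgroup (GL (Fin n) F)) (hG : SLinGL n F ≤ G) :
    (gammaCover G : ℤ) ≤
      ⌊((1 - 1 / (p : ℚ)) * n / 2 : ℚ)⌋ + 1 +
        (if p = 2 ∧ Odd (n / 2) then 1 else 0) := by
  obtain ⟨r, hr⟩ := CharP.exists F
  have : Fact r.Prime := ⟨CharP.char_is_prime F r⟩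
  have : NeZero p := ⟨hp.ne_zero⟩
  let E := FiniteField.Extension F r p
  have hE : finrank F E = p := FiniteField.finrank_extension F r p
  have : FiniteDimensional F E := Module.Finite.of_finite
  obtain ⟨ψ⟩ := exists_algHom_matrix (F := F) (E := E) (hE ▸ hpn)
  let S := (Finset.Icc 1 (n / 2)).filter fun k => ¬ p ∣ k
  have hS (k : S) : 1 ≤ k.1 ∧ k.1 ≤ n / 2 :=
    Finset.mem_Icc.1 (Finset.mem_filter.1 k.2).1
  choose W hWfin hWmem using fun k : S =>
    exists_submodule_finrank_eq_s14 n k.1 F ((hS k).2.trans (Nat.div_le_self n 2))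
  let H : Option S → Subgroup G
    | none => algHomCentralizer G ψ
    | some k => subspaceStabilizer G (W k)
  have hH (i : Option S) : H i ≠ ⊤ := by
    cases i with
    | none => exact algHomCentralizer_ne_top (by omega) G hG ψ (hE.trans_ne hp.ne_one)
    | some k =>
      have := hS k
      refine subspaceStabilizer_ne_top G hG (W k) ⟨n - 1, by omega⟩ ⟨0, by omega⟩ ?_ ?_
      · rw [hWmem]
        dsimp only
        omega
      · rw [hWmem]
        dsimp only
        omega
  have hcov (g : G) : ∃ i, ∃ x : G, x * g * x⁻¹ ∈ H i := by
    let T := Matrix.toLin' (g.1 : Matrix (Fin n) (Fin n) F)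
    have hdeg : T.charpoly.natDegree = n := by
      rw [LinearMap.charpoly_natDegree, finrank_fin_fun]
    have hP0 := T.charpoly_monic.ne_zero
    by_cases hall : ∀ f : F[X], Irreducible f → f ∣ T.charpoly → p ∣ f.natDegree
    · refine ⟨none, ?_⟩
      have haeval : aeval (g.1 : Matrix (Fin n) (Fin n) F) T.charpoly = 0 := by
        rw [Matrix.charpoly_toLin', Matrix.aeval_self_charpoly]
      obtain ⟨φ, hφ⟩ := nonempty_algHom_of_finrank_dvd_irreducible_factors (E := E) _ _ hP0 haeval
        fun f hf hfT => hE.symm ▸ hall f hf hfT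
      exact exists_conj_mem_algHomCentralizer (by omega) G hG φ ψ g hφ
    · push Not at hall
      obtain ⟨f, hf, hfT, hpf⟩ := hall
      obtain ⟨d, hd, hdT, hpd, hle⟩ := exists_irreducible_dvd_not_dvd_natDegree_le_half p
        T.charpoly (hdeg.symm ▸ hpn) hP0 f hf hfT hpf
      obtain ⟨U, hU, hTU⟩ := exists_submodule_finrank_eq_of_dvd_charpoly T d hd hdT
      have hdS : d.natDegree ∈ S :=
        Finset.mem_filter.2 ⟨Finset.mem_Icc.2 ⟨hd.natDegree_pos, hdeg ▸ hle⟩, hpd⟩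
      refine ⟨some ⟨_, hdS⟩, exists_conj_mem_subspaceStabilizer G hG U _ ?_ ?_ g hTU⟩
      · rw [hU, hWfin]
      · intro hbot
        have := hWfin ⟨_, hdS⟩
        rw [hbot, finrank_bot] at this
        exact hd.natDegree_pos.ne this
  have hle : gammaCover G ≤ S.card + 1 := by
    have := IsNormalCover.of_fintype H hH hcov
    rw [Fintype.card_option, Fintype.card_coe] at this
    exact Nat.sInf_le this
  rw [card_filter_not_dvd] at hle
  have := half_sub_half_div_le n p hp hpn
  zify at hle
  linarith
end

section
/- Let n be an integer with at least three distinct prime divisors, suppose n is not equal to 6r or 10r for any prime r, and let p be a prime divisor of n. Then there exists an integer w with (n−2)/4 ≤ w < n/2 such that p divides w and no prime divisor of n other than p divides w; moreover, if p ≠ 3 then w may additionally be chosen so that 3 does not divide w. -/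
theorem not_dvd_eight_of_three_le_card_primeFactors_mul {p N : ℕ} (hp : p.Prime)
    (h : 3 ≤ (p * N).primeFactors.card) : ¬ N ∣ 8 := by
  intro hN
  have hsub : (p * N).primeFactors ⊆ {p, 2} := by
    intro r hr
    have hr' := Nat.prime_of_mem_primeFactors hr
    rcases hr'.dvd_mul.1 (Nat.dvd_of_mem_primeFactors hr) with hd | hd
    · simp [(Nat.prime_dvd_prime_iff_eq hr' hp).1 hd]
    · have : r ∣ 2 := hr'.dvd_of_dvd_pow (show r ∣ 2 ^ 3 from hd.trans hN)
      simp [(Nat.prime_dvd_prime_iff_eq hr' Nat.prime_two).1 this]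
  exact absurd (h.trans ((Finset.card_le_card hsub).trans Finset.card_le_two)) (by norm_num)

theorem exists_two_pow_mem_quarter_half {N : ℕ} (hN : 3 ≤ N) :
    ∃ j : ℕ, N ≤ 4 * 2 ^ j ∧ 2 * 2 ^ j < N := by
  have hlt := Nat.pow_pred_clog_lt_self (b := 2) (by norm_num) (x := N) (by omega)
  have hle := Nat.le_pow_clog (b := 2) (by norm_num) N
  obtain ⟨j, hj⟩ : ∃ j, Nat.clog 2 N = j + 2 := by
    refine Nat.exists_eq_add_of_le' ?_
    by_contra! hc
    have := Nat.pow_le_pow_right (n := 2) (by norm_num) (Nat.le_of_lt_succ hc)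
    omega
  rw [hj] at hlt hle
  rw [Nat.pred_eq_sub_one, show j + 2 - 1 = j + 1 by omega] at hlt
  exact ⟨j, by rw [pow_add] at hle; omega, by rw [pow_succ] at hlt; omega⟩

/-- Away from small cases, an even number `2 * M` has a number coprime to `6 * M` in the second
quarter of `[0, 2 * M]`. -/
theorem exists_coprime_mem_quarter_half (M : ℕ) (h1 : M ≠ 1) (h3 : M ≠ 3) (h4 : M ≠ 4)
    (h5 : M ≠ 5) (h0 : M ≠ 0) :
    ∃ k : ℕ, 2 * M ≤ 4 * k ∧ k < M ∧ (∀ r : ℕ, r.Prime → r ∣ 2 * M → ¬ r ∣ k) ∧ ¬ 3 ∣ k := by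
  obtain ⟨d, hd0, hdM, hodd, h3d, hdiv⟩ : ∃ d : ℕ, 0 < d ∧ 2 * d ≤ M ∧ (M - d) % 2 = 1 ∧
      ¬ 3 ∣ M - d ∧ (d = 1 ∨ d = 2 ∨ d = 4 ∨ d = 3 ∧ ¬ 3 ∣ M) := by
    by_cases hM2 : M % 2 = 0
    · by_cases hM3 : M % 3 = 1
      · exact ⟨3, by omega, by omega, by omega, by omega, by omega⟩
      · exact ⟨1, by omega, by omega, by omega, by omega, by omega⟩
    · by_cases hM3 : M % 3 = 2
      · exact ⟨4, by omega, by omega, by omega, by omega, by omega⟩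
      · exact ⟨2, by omega, by omega, by omega, by omega, by omega⟩
  refine ⟨M - d, by omega, by omega, fun r hr hrM hrk => ?_, h3d⟩
  have hr2 : r ≠ 2 := by rintro rfl; omega
  have hM : r ∣ M := (hr.dvd_mul.1 hrM).resolve_left fun h =>
    hr2 ((Nat.prime_dvd_prime_iff_eq hr Nat.prime_two).1 h)
  have hrd : r ∣ d := (Nat.dvd_sub_iff_right (by omega) hM).1 hrk
  have not_two_pow : ∀ e, ¬ r ∣ 2 ^ e := fun e h =>
    hr2 ((Nat.prime_dvd_prime_iff_eq hr Nat.prime_two).1 (hr.dvd_of_dvd_pow h))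
  rcases hdiv with rfl | rfl | rfl | ⟨rfl, h⟩
  · exact not_two_pow 0 hrd
  · exact not_two_pow 1 hrd
  · exact not_two_pow 2 hrd
  · exact h ((Nat.prime_dvd_prime_iff_eq hr Nat.prime_three).1 hrd ▸ hM)

theorem exists_w_p
    (n p : ℕ) (hν : 3 ≤ n.primeFactors.card)
    (hn : ¬ ∃ r : ℕ, r.Prime ∧ (n = 6 * r ∨ n = 10 * r))
    (hp : p.Prime) (hpn : p ∣ n) :
    ∃ w : ℕ, ((n : ℚ) - 2) / 4 ≤ (w : ℚ) ∧ (w : ℚ) < (n : ℚ) / 2 ∧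
      p ∣ w ∧ (∀ r : ℕ, r.Prime → r ∣ n → r ∣ w → r = p) ∧
      (p ≠ 3 → ¬ (3 ∣ w)) := by
  obtain ⟨N, rfl⟩ := hpn
  have h8 := not_dvd_eight_of_three_le_card_primeFactors_mul hp hν
  have hN0 : N ≠ 0 := by rintro rfl; simp at hν
  have hN1 : N ≠ 1 := by rintro rfl; exact h8 (by norm_num)
  have hN2 : N ≠ 2 := by rintro rfl; exact h8 (by norm_num)
  have hN8 : N ≠ 8 := by rintro rfl; exact h8 (by norm_num)
  have hN6 : N ≠ 6 := by rintro rfl; exact hn ⟨p, hp, Or.inl (mul_comm _ _)⟩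
  have hN10 : N ≠ 10 := by rintro rfl; exact hn ⟨p, hp, Or.inr (mul_comm _ _)⟩
  obtain ⟨k, hk4, hk2, hkr, hk3⟩ : ∃ k : ℕ, N ≤ 4 * k ∧ 2 * k < N ∧
      (∀ r : ℕ, r.Prime → r ∣ N → r ∣ k → r = p) ∧ ¬ 3 ∣ k := by
    by_cases hodd : p = 2 ∨ ¬ 2 ∣ N
    · obtain ⟨j, hj4, hj2⟩ := exists_two_pow_mem_quarter_half (N := N) (by omega)
      refine ⟨2 ^ j, hj4, hj2, fun r hr hrN hrj => ?_, fun h => ?_⟩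
      · have hr2 := (Nat.prime_dvd_prime_iff_eq hr Nat.prime_two).1 (hr.dvd_of_dvd_pow hrj)
        subst hr2
        exact (hodd.resolve_right (not_not.2 hrN)).symm
      · exact absurd (Nat.prime_three.dvd_of_dvd_pow h) (by norm_num)
    · push Not at hodd
      obtain ⟨M, rfl⟩ := hodd.2
      obtain ⟨k, hk4, hk2, hkr, hk3⟩ := exists_coprime_mem_quarter_half M (by omega) (by omega)
        (by omega) (by omega) (by omega)
      exact ⟨k, hk4, by omega, fun r hr hrM hrk => absurd hrk (hkr r hr hrM), hk3⟩
  have hp0 : (0 : ℚ) < p := by exact_mod_cast hp.pos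
  have hk4' : (N : ℚ) ≤ 4 * k := by exact_mod_cast hk4
  have hk2' : (2 : ℚ) * k < N := by exact_mod_cast hk2
  refine ⟨p * k, ?_, ?_, dvd_mul_right _ _, fun r hr hrn hrw => ?_, fun hp3 h => ?_⟩
  · push_cast
    nlinarith [mul_le_mul_of_nonneg_left hk4' hp0.le]
  · push_cast
    nlinarith [mul_lt_mul_of_pos_left hk2' hp0]
  · by_contra hne
    have hrp : ¬ r ∣ p := fun h => hne ((Nat.prime_dvd_prime_iff_eq hr hp).1 h)
    exact hne (hkr r hr ((hr.dvd_mul.1 hrn).resolve_left hrp)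
      ((hr.dvd_mul.1 hrw).resolve_left hrp))
  · rcases Nat.prime_three.dvd_mul.1 h with h | h
    · exact hp3 ((Nat.prime_dvd_prime_iff_eq Nat.prime_three hp).1 h).symm
    · exact hk3 h
end

section
/- For a positive integer n, let g(n) denote the number of partitions of n into exactly three positive integer parts whose greatest common divisor is 1. Then n²/(2π²) − (2/3)·√n < g(n), where π is the real number pi. -/
/-- The number of partitions of `n` into exactly three positive integer parts with
greatest common divisor `1`, counted as weakly increasing triples. -/
def threeCoprimePartitions (n : ℕ) : ℕ :=
  ((Finset.range (n + 1) ×ˢ Finset.range (n + 1) ×ˢ Finset.range (n + 1)).filter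
    (fun t : ℕ × ℕ × ℕ =>
      0 < t.1 ∧ t.1 ≤ t.2.1 ∧ t.2.1 ≤ t.2.2 ∧ t.1 + t.2.1 + t.2.2 = n ∧
      Nat.gcd t.1 (Nat.gcd t.2.1 t.2.2) = 1)).card

/-- The weakly increasing triples of positive integers with sum `n`. -/
def increasingTriples (n : ℕ) : Finset (ℕ × ℕ × ℕ) :=
  (Finset.range (n + 1) ×ˢ Finset.range (n + 1) ×ˢ Finset.range (n + 1)).filter
    (fun t : ℕ × ℕ × ℕ => 0 < t.1 ∧ t.1 ≤ t.2.1 ∧ t.2.1 ≤ t.2.2 ∧ t.1 + t.2.1 + t.2.2 = n)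

lemma mem_increasingTriples {n a b c : ℕ} :
    (a, b, c) ∈ increasingTriples n ↔ 0 < a ∧ a ≤ b ∧ b ≤ c ∧ a + b + c = n := by
  simp only [increasingTriples, Finset.mem_filter, Finset.mem_product, Finset.mem_range]
  omega

lemma threeCoprimePartitions_eq_card (n : ℕ) :
    threeCoprimePartitions n =
      ((increasingTriples n).filter fun t => Nat.gcd t.1 (Nat.gcd t.2.1 t.2.2) = 1).card := by
  rw [threeCoprimePartitions, increasingTriples, Finset.filter_filter]
  simp only [and_assoc]

lemma card_increasingTriples_add_three (n : ℕ) :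
    (increasingTriples (n + 3)).card = (increasingTriples n).card + (n / 2 + 1) := by
  rw [← Finset.card_filter_add_card_filter_not (s := increasingTriples (n + 3))
    (fun t => 1 < t.1)]
  congr 1
  · refine Finset.card_nbij' (fun t => (t.1 - 1, t.2.1 - 1, t.2.2 - 1))
      (fun t => (t.1 + 1, t.2.1 + 1, t.2.2 + 1)) ?_ ?_ ?_ ?_ <;>
    · rintro ⟨a, b, c⟩ h
      simp only [Finset.coe_filter, Set.mem_ofPred_eq, Finset.mem_coe, mem_increasingTriples,
        Prod.mk.injEq] at h ⊢
      omega
  · rw [show n / 2 + 1 = (Finset.Icc 1 (n / 2 + 1)).card by simp]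
    refine Finset.card_nbij' (fun t => t.2.1) (fun b => (1, b, n + 2 - b)) ?_ ?_ ?_ ?_
    · rintro ⟨a, b, c⟩ h
      simp only [Finset.coe_filter, Set.mem_ofPred_eq, mem_increasingTriples,
        Finset.coe_Icc, Set.mem_Icc] at h ⊢
      omega
    · intro b h
      simp only [Finset.coe_filter, Set.mem_ofPred_eq, mem_increasingTriples,
        Finset.coe_Icc, Set.mem_Icc] at h ⊢
      omega
    · rintro ⟨a, b, c⟩ h
      simp only [Finset.coe_filter, Set.mem_ofPred_eq, mem_increasingTriples,
        Prod.mk.injEq, true_and] at h ⊢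
      omega
    · intro b h
      rfl

lemma twelve_mul_card_increasingTriples (n : ℕ) :
    12 * ((increasingTriples n).card : ℤ) =
      n ^ 2 - 1 - (if 2 ∣ n then 3 else 0) + (if 3 ∣ n then 4 else 0) := by
  induction n using Nat.strong_induction_on with
  | _ n ih =>
    match n with
    | 0 => decide
    | 1 => decide
    | 2 => decide
    | n + 3 =>
      have h := ih n (by omega)
      rw [card_increasingTriples_add_three]
      push_cast at h ⊢
      rw [mul_add, h]
      have h3 : (3 ∣ n + 3) ↔ 3 ∣ n := by omega
      simp only [h3]
      rcases Nat.even_or_odd' n with ⟨k, rfl | rfl⟩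
      · rw [if_pos (by omega : 2 ∣ 2 * k), if_neg (by omega : ¬ 2 ∣ 2 * k + 3),
          show ((2 * k : ℕ) : ℤ) / 2 = k by omega]
        push_cast
        ring
      · rw [if_neg (by omega : ¬ 2 ∣ 2 * k + 1), if_pos (by omega : 2 ∣ 2 * k + 1 + 3),
          show ((2 * k + 1 : ℕ) : ℤ) / 2 = k by omega]
        push_cast
        ring

lemma card_increasingTriples_filter_gcd_eq {n d : ℕ} (hn : 0 < n) (hd : d ∣ n) :
    ((increasingTriples n).filter fun t => Nat.gcd t.1 (Nat.gcd t.2.1 t.2.2) = d).card =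
      threeCoprimePartitions (n / d) := by
  obtain ⟨m, rfl⟩ := hd
  have hd0 : 0 < d := Nat.pos_of_mul_pos_right hn
  rw [Nat.mul_div_cancel_left _ hd0, threeCoprimePartitions_eq_card]
  symm
  refine Finset.card_nbij (fun t => (d * t.1, d * t.2.1, d * t.2.2)) ?_ ?_ ?_
  · rintro ⟨a, b, c⟩ h
    simp only [Finset.coe_filter, Set.mem_ofPred_eq, mem_increasingTriples] at h ⊢
    obtain ⟨⟨h1, h2, h3, rfl⟩, h4⟩ := h
    refine ⟨⟨by positivity, by gcongr, by gcongr, by ring⟩, ?_⟩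
    rw [Nat.gcd_mul_left, Nat.gcd_mul_left, h4, mul_one]
  · rintro ⟨a, b, c⟩ - ⟨a', b', c'⟩ - h
    simpa [hd0.ne'] using h
  · rintro ⟨a, b, c⟩ h
    simp only [Finset.coe_filter, Set.mem_ofPred_eq, mem_increasingTriples] at h
    obtain ⟨⟨h1, h2, h3, h4⟩, h5⟩ := h
    obtain ⟨a, rfl⟩ : d ∣ a := h5 ▸ Nat.gcd_dvd_left _ _
    have hbc : d ∣ Nat.gcd b c := by
      conv_lhs => rw [← h5]
      exact Nat.gcd_dvd_right _ _
    obtain ⟨b, rfl⟩ := hbc.trans (Nat.gcd_dvd_left _ _)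
    obtain ⟨c, rfl⟩ := hbc.trans (Nat.gcd_dvd_right _ _)
    refine ⟨(a, b, c), ?_, rfl⟩
    simp only [Finset.coe_filter, Set.mem_ofPred_eq, mem_increasingTriples]
    rw [Nat.gcd_mul_left, Nat.gcd_mul_left] at h5
    refine ⟨⟨Nat.pos_of_mul_pos_left h1, Nat.le_of_mul_le_mul_left h2 hd0,
      Nat.le_of_mul_le_mul_left h3 hd0, Nat.eq_of_mul_eq_mul_left hd0 ?_⟩,
      Nat.eq_of_mul_eq_mul_left hd0 (h5.trans (mul_one d).symm)⟩
    rw [← h4]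
    ring

lemma sum_divisors_threeCoprimePartitions {n : ℕ} (hn : 0 < n) :
    ∑ d ∈ n.divisors, threeCoprimePartitions d = (increasingTriples n).card := by
  rw [← Nat.sum_div_divisors, Finset.card_eq_sum_card_fiberwise (t := n.divisors)
    (f := fun t : ℕ × ℕ × ℕ => Nat.gcd t.1 (Nat.gcd t.2.1 t.2.2))]
  · exact Finset.sum_congr rfl fun d hd =>
      (card_increasingTriples_filter_gcd_eq hn (Nat.dvd_of_mem_divisors hd)).symm
  · rintro ⟨a, b, c⟩ h
    simp only [Finset.mem_coe, mem_increasingTriples, Nat.mem_divisors] at h ⊢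
    obtain ⟨-, -, -, rfl⟩ := h
    have h1 := Nat.gcd_dvd_right a (Nat.gcd b c)
    exact ⟨((Nat.gcd_dvd_left _ _).add (h1.trans (Nat.gcd_dvd_left _ _))).add
      (h1.trans (Nat.gcd_dvd_right _ _)), hn.ne'⟩

lemma sum_divisors_twelve_mul_threeCoprimePartitions {n : ℕ} (hn : 0 < n) :
    ∑ d ∈ n.divisors, (12 * (threeCoprimePartitions d : ℝ) + (if d = 1 then 1 else 0)
      + (if d = 2 then 3 else 0) - (if d = 3 then 4 else 0)) = (n : ℝ) ^ 2 := by
  have h := twelve_mul_card_increasingTriples n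
  rw [← sum_divisors_threeCoprimePartitions hn] at h
  have h' := congrArg (Int.cast : ℤ → ℝ) h
  push_cast at h'
  simp only [Finset.sum_sub_distrib, Finset.sum_add_distrib, ← Finset.mul_sum,
    Finset.sum_ite_eq', Nat.mem_divisors, h']
  simp only [Nat.one_dvd, hn.ne', ne_eq, not_false_eq_true, and_true, if_true]
  ring

open ArithmeticFunction in
lemma sum_divisors_moebius_div_sq {n : ℕ} (hn : n ≠ 0) :
    ∑ d ∈ n.divisors, (moebius d : ℝ) / (d : ℝ) ^ 2 =
      ∏ p ∈ n.primeFactors, (1 - 1 / (p : ℝ) ^ 2) := by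
  let f : ArithmeticFunction ℝ := ⟨fun d => (moebius d : ℝ) / (d : ℝ) ^ 2, by simp⟩
  have hf : f.IsMultiplicative := by
    refine ⟨by simp [f], fun {m n} h => ?_⟩
    simp only [f, coe_mk, isMultiplicative_moebius.map_mul_of_coprime h]
    push_cast
    rw [mul_pow, div_mul_div_comm]
  have hmul : (((zeta : ArithmeticFunction ℕ) : ArithmeticFunction ℝ) * f).IsMultiplicative :=
    isMultiplicative_zeta.natCast.mul hf
  have key := hmul.multiplicative_factorization _ hn
  rw [coe_zeta_mul_apply] at key
  refine key.trans (Finset.prod_congr (by simp) fun p hp => ?_)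
  have hp' : p.Prime := Nat.prime_of_mem_primeFactors (by simpa using hp)
  have hk : n.factorization p ≠ 0 :=
    Finsupp.mem_support_iff.1 (by simpa using hp)
  obtain ⟨k, hk⟩ := Nat.exists_eq_succ_of_ne_zero hk
  beta_reduce
  rw [hk, coe_zeta_mul_apply, Nat.sum_divisors_prime_pow hp', Finset.sum_range_succ',
    Finset.sum_range_succ', Finset.sum_eq_zero]
  · simp [f, moebius_apply_prime hp']
    ring
  · intro i _
    simp [f, moebius_apply_prime_pow hp' (by omega : i + 1 + 1 ≠ 0)]

lemma six_div_pi_sq_le_prod (n : ℕ) :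
    6 / Real.pi ^ 2 ≤ ∏ p ∈ n.primeFactors, (1 - 1 / (p : ℝ) ^ 2) := by
  let f : ℕ →* ℝ :=
    { toFun := fun m => 1 / (m : ℝ) ^ 2
      map_one' := by simp
      map_mul' := fun a b => by push_cast; rw [mul_pow, one_div_mul_one_div] }
  have hlt {p : ℕ} (hp : p.Prime) : 1 / (p : ℝ) ^ 2 < 1 := by
    have : (1 : ℝ) < p := by exact_mod_cast hp.one_lt
    rw [div_lt_one (by positivity)]
    exact one_lt_pow₀ this two_ne_zero
  have hsum := (EulerProduct.summable_and_hasSum_factoredNumbers_prod_filter_prime_geometric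
    (f := f) (fun {p} hp => by
      rw [Real.norm_of_nonneg (by simp only [f, MonoidHom.coe_mk, OneHom.coe_mk]; positivity)]
      exact hlt hp) n.primeFactors).2
  have hle : ∏ p ∈ n.primeFactors with p.Prime, (1 - f p)⁻¹ ≤ Real.pi ^ 2 / 6 :=
    hasSum_le_inj (fun m : Nat.factoredNumbers n.primeFactors => (m : ℕ)) Subtype.val_injective
      (fun m _ => one_div_nonneg.2 (sq_nonneg _)) (fun m => le_rfl) hsum hasSum_zeta_two
  rw [Finset.filter_true_of_mem fun p hp => Nat.prime_of_mem_primeFactors hp,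
    Finset.prod_inv_distrib] at hle
  have hpos : 0 < ∏ p ∈ n.primeFactors, (1 - 1 / (p : ℝ) ^ 2) :=
    Finset.prod_pos fun p hp => sub_pos.2 (hlt (Nat.prime_of_mem_primeFactors hp))
  have := inv_le_of_inv_le₀ hpos hle
  rwa [inv_div] at this

open ArithmeticFunction in
lemma six_div_pi_sq_mul_sq_le_of_sum_divisors_eq_sq {f : ℕ → ℝ}
    (hf : ∀ n : ℕ, 0 < n → ∑ d ∈ n.divisors, f d = (n : ℝ) ^ 2) {n : ℕ} (hn : 0 < n) :
    6 / Real.pi ^ 2 * (n : ℝ) ^ 2 ≤ f n := by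
  have hn' : (n : ℝ) ≠ 0 := by positivity
  have h : f n = (∑ d ∈ n.divisors, (moebius d : ℝ) / (d : ℝ) ^ 2) * (n : ℝ) ^ 2 := by
    rw [← sum_eq_iff_sum_mul_moebius_eq.1 hf n hn, Finset.sum_mul,
      Nat.sum_divisorsAntidiagonal (fun a b => (moebius a : ℝ) * (b : ℝ) ^ 2)]
    refine Finset.sum_congr rfl fun d hd => ?_
    rw [Nat.cast_div_charZero (Nat.dvd_of_mem_divisors hd)]
    ring
  rw [h, sum_divisors_moebius_div_sq hn.ne']
  gcongr
  exact six_div_pi_sq_le_prod n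

theorem threeCoprimePartitions_lower_bound (n : ℕ) (hn : 0 < n) :
    (n : ℝ) ^ 2 / (2 * Real.pi ^ 2) - (2 / 3) * Real.sqrt n
      < (threeCoprimePartitions n : ℝ) := by
  have h := six_div_pi_sq_mul_sq_le_of_sum_divisors_eq_sq
    (fun m hm => sum_divisors_twelve_mul_threeCoprimePartitions hm) hn
  have hs : 1 ≤ Real.sqrt n := Real.one_le_sqrt.2 (by exact_mod_cast hn)
  have he : (n : ℝ) ^ 2 / (2 * Real.pi ^ 2) = 6 / Real.pi ^ 2 * (n : ℝ) ^ 2 / 12 := by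
    field_simp
    norm_num
  rw [he]
  split_ifs at h <;> first | omega | linarith
end
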